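/- arXiv:1603.01744 — 4 statements merged into one kernel-verified Lean document; each statement's English description precedes it below -/
import Mathlib

section
/- Let M ≥ 2, d ≥ 2 and let A = (A_1,…,A_M) be an irreducible tuple of d×d real matrices. Then there exists δ > 0 such that for every pair of d×d real matrices B_1, B_2 there exist an integer k with 0 ≤ k < d and indices i_1,…,i_k ∈ {1,…,M} such that ‖B_1 A_{i_1} ⋯ A_{i_k} B_2‖ ≥ δ ‖B_1‖·‖B_2‖ (a product of length zero is interpreted as the identity matrix). -/
open MeasureTheory Filter Topology

/-- The operator norm on square real matrices induced by the Euclidean norm. -/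
noncomputable def opNorm {n : Type*} [Fintype n] [DecidableEq n]
    (X : Matrix n n ℝ) : ℝ :=
  ‖Matrix.toEuclideanCLM (𝕜 := ℝ) X‖

/-- The spectral radius `ρ(X) = inf_{k ≥ 1} ‖X^k‖^(1/k)` (Gelfand). -/
noncomputable def specRad {n : Type*} [Fintype n] [DecidableEq n]
    (X : Matrix n n ℝ) : ℝ :=
  ⨅ k : ℕ, opNorm (X ^ (k + 1)) ^ ((1 : ℝ) / (k + 1))

/-- The product `A_{x_n} ⋯ A_{x_1}` associated to the word `x = (x_1, …, x_n)`. -/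
noncomputable def wordProd {M d n : ℕ} (A : Fin M → Matrix (Fin d) (Fin d) ℝ)
    (x : Fin n → Fin M) : Matrix (Fin d) (Fin d) ℝ :=
  (List.ofFn (fun i => A (x i))).reverse.prod

/-- The product `A_{x_n} ⋯ A_{x_1}` associated to the word `w = [x_1, …, x_n]`. -/
noncomputable def listProd {M d : ℕ} (A : Fin M → Matrix (Fin d) (Fin d) ℝ)
    (w : List (Fin M)) : Matrix (Fin d) (Fin d) ℝ :=
  ((w.map A).reverse).prod

/-- Irreducibility: no invariant subspace `U` with `0 < dim U < d`. -/
def IsIrredTuple {M d : ℕ} (A : Fin M → Matrix (Fin d) (Fin d) ℝ) : Prop :=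
  ¬ ∃ U : Submodule ℝ (Fin d → ℝ),
      (∀ i, U.map (A i).mulVecLin ≤ U) ∧ U ≠ ⊥ ∧ U ≠ ⊤

/-- The shift map on `Σ_M = {1,…,M}^ℕ`. -/
def shift {M : ℕ} : (ℕ → Fin M) → (ℕ → Fin M) := fun x n => x (n + 1)

/-- The cylinder set `[x_1 ⋯ x_n]` determined by the word `w = [x_1, …, x_n]`. -/
def cyl {M : ℕ} (w : List (Fin M)) : Set (ℕ → Fin M) :=
  {y | ∀ i : Fin w.length, y (i : ℕ) = w.get i}

/-- The Gibbs inequality for `(A, s)` with constants `C > 0`, `P ∈ ℝ`. -/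
def IsGibbs {M d : ℕ} (A : Fin M → Matrix (Fin d) (Fin d) ℝ) (s C P : ℝ)
    (μ : Measure (ℕ → Fin M)) : Prop :=
  ∀ w : List (Fin M), w ≠ [] →
    C⁻¹ * (μ (cyl w)).toReal ≤ Real.exp (-(w.length : ℝ) * P) * opNorm (listProd A w) ^ s ∧
    Real.exp (-(w.length : ℝ) * P) * opNorm (listProd A w) ^ s ≤ C * (μ (cyl w)).toReal

/-- The pressure `P(A,s) = inf_{n ≥ 1} (1/n) log Σ_{|x| = n} ‖A_{x_n} ⋯ A_{x_1}‖^s ∈ [-∞, ∞)`,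
with the convention that a term is `-∞` when the corresponding sum vanishes. -/
noncomputable def pressure {M d : ℕ} (A : Fin M → Matrix (Fin d) (Fin d) ℝ) (s : ℝ) : EReal :=
  ⨅ n : ℕ,
    if (∑ x : Fin (n + 1) → Fin M, opNorm (wordProd A x) ^ s) = 0 then (⊥ : EReal)
    else ((Real.log (∑ x : Fin (n + 1) → Fin M, opNorm (wordProd A x) ^ s) / (n + 1) : ℝ) : EReal)

/-- The span of the vectors `A_w v` over words `w` of length at most `k`. -/
def wspan {M d : ℕ} (A : Fin M → Matrix (Fin d) (Fin d) ℝ) (v : Fin d → ℝ) (k : ℕ) :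
    Submodule ℝ (Fin d → ℝ) :=
  Submodule.span ℝ {x | ∃ w : List (Fin M), w.length ≤ k ∧ x = (listProd A w).mulVec v}

lemma wspan_mono {M d : ℕ} (A : Fin M → Matrix (Fin d) (Fin d) ℝ) (v : Fin d → ℝ) (k : ℕ) :
    wspan A v k ≤ wspan A v (k + 1) := by
  apply Submodule.span_mono
  rintro x ⟨w, hw, rfl⟩
  exact ⟨w, by omega, rfl⟩

lemma wspan_map {M d : ℕ} (A : Fin M → Matrix (Fin d) (Fin d) ℝ) (v : Fin d → ℝ) (k : ℕ)
    (i : Fin M) : (wspan A v k).map (A i).mulVecLin ≤ wspan A v (k + 1) := by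
  unfold wspan
  rw [Submodule.map_span_le]
  rintro x ⟨w, hw, rfl⟩
  apply Submodule.subset_span
  refine ⟨w ++ [i], by simpa using hw, ?_⟩
  simp [listProd, Matrix.mulVec_mulVec]

lemma mem_wspan {M d : ℕ} (A : Fin M → Matrix (Fin d) (Fin d) ℝ) (v : Fin d → ℝ) (k : ℕ) :
    v ∈ wspan A v k := by
  apply Submodule.subset_span
  exact ⟨[], by simp, by simp [listProd]⟩

lemma wspan_dim {M d : ℕ} (A : Fin M → Matrix (Fin d) (Fin d) ℝ) (hA : IsIrredTuple A)
    (v : Fin d → ℝ) (hv : v ≠ 0) (k : ℕ) :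
    wspan A v k = ⊤ ∨ k + 1 ≤ Module.finrank ℝ (wspan A v k) := by
  have hne : ∀ k, wspan A v k ≠ ⊥ := fun k h => hv (by
    have := mem_wspan A v k
    rw [h] at this
    simpa using this)
  induction k with
  | zero =>
    right
    exact Submodule.one_le_finrank_iff.mpr (hne 0)
  | succ k ih =>
    by_cases htop : wspan A v k = ⊤
    · left
      exact top_le_iff.mp (htop ▸ wspan_mono A v k)
    · right
      have h1 := ih.resolve_left htop
      have hlt : wspan A v k < wspan A v (k + 1) := by
        refine lt_of_le_of_ne (wspan_mono A v k) fun h => ?_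
        exact hA ⟨wspan A v k, fun i => (wspan_map A v k i).trans h.ge, hne k, htop⟩
      have := Submodule.finrank_lt_finrank_of_lt hlt
      omega

lemma wspan_top {M d : ℕ} (hd : 2 ≤ d) (A : Fin M → Matrix (Fin d) (Fin d) ℝ)
    (hA : IsIrredTuple A) (v : Fin d → ℝ) (hv : v ≠ 0) : wspan A v (d - 1) = ⊤ := by
  rcases wspan_dim A hA v hv (d - 1) with h | h
  · exact h
  · apply Submodule.eq_top_of_finrank_eq
    have := Submodule.finrank_le (wspan A v (d - 1))
    simp at this ⊢
    omega

lemma exists_ne_zero {M d : ℕ} (hd : 2 ≤ d) (A : Fin M → Matrix (Fin d) (Fin d) ℝ)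
    (hA : IsIrredTuple A) (B₁ B₂ : Matrix (Fin d) (Fin d) ℝ) (h1 : B₁ ≠ 0) (h2 : B₂ ≠ 0) :
    ∃ w : List (Fin M), w.length < d ∧ B₁ * listProd A w * B₂ ≠ 0 := by
  by_contra! hcon
  apply h1
  obtain ⟨u, hu⟩ : ∃ u, B₂.mulVec u ≠ 0 := by
    by_contra! h
    exact h2 (Matrix.ext_of_mulVec_single fun i => by
      rw [h, Matrix.zero_mulVec])
  have hle : wspan A (B₂.mulVec u) (d - 1) ≤ LinearMap.ker B₁.mulVecLin := by
    unfold wspan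
    rw [Submodule.span_le]
    rintro x ⟨w, hw, rfl⟩
    have := hcon w (by omega)
    simp only [SetLike.mem_coe, LinearMap.mem_ker, Matrix.mulVecLin_apply, Matrix.mulVec_mulVec]
    rw [← Matrix.mul_assoc, this, Matrix.zero_mulVec]
  rw [wspan_top hd A hA _ hu] at hle
  refine Matrix.ext_of_mulVec_single fun i => ?_
  have : (Pi.single i 1 : Fin d → ℝ) ∈ LinearMap.ker B₁.mulVecLin := hle trivial
  rw [Matrix.zero_mulVec]
  exact this

lemma norm_normalize {R : Type*} [NormedRing R] [NormedAlgebra ℝ R] (x : R) (hx : x ≠ 0) :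
    ‖‖x‖⁻¹ • x‖ = 1 := by
  have := norm_pos_iff.2 hx
  rw [norm_smul, norm_inv, norm_norm, inv_mul_cancel₀ this.ne']

lemma norm_smul_mul_smul {R : Type*} [NormedRing R] [NormedAlgebra ℝ R] (a b : ℝ)
    (ha : 0 ≤ a) (hb : 0 ≤ b) (x y z : R) :
    ‖(a • x) * y * (b • z)‖ = a * b * ‖x * y * z‖ := by
  rw [smul_mul_assoc, smul_mul_assoc, mul_smul_comm, norm_smul, norm_smul,
    Real.norm_of_nonneg ha, Real.norm_of_nonneg hb, ← mul_assoc a b]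

/-- irreducibility lemma (Lemma `le:ire`). -/
theorem stmt_0 {M d : ℕ} (hM : 2 ≤ M) (hd : 2 ≤ d)
    (A : Fin M → Matrix (Fin d) (Fin d) ℝ) (hA : IsIrredTuple A) :
    ∃ δ : ℝ, 0 < δ ∧ ∀ B₁ B₂ : Matrix (Fin d) (Fin d) ℝ,
      ∃ w : List (Fin M), w.length < d ∧
        δ * (opNorm B₁ * opNorm B₂) ≤ opNorm (B₁ * listProd A w * B₂) := by
  classical
  let Φ := Matrix.toEuclideanCLM (n := Fin d) (𝕜 := ℝ)
  have hfin : {w : List (Fin M) | w.length < d}.Finite := List.finite_length_lt (Fin M) d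
  let S := hfin.toFinset
  have hS : ∀ w, w ∈ S ↔ w.length < d := fun w => by simp [S]
  have hSne : S.Nonempty := ⟨[], by rw [hS]; simp; omega⟩
  have : ProperSpace (EuclideanSpace ℝ (Fin d) →L[ℝ] EuclideanSpace ℝ (Fin d)) := FiniteDimensional.proper ℝ _
  let F : (EuclideanSpace ℝ (Fin d) →L[ℝ] EuclideanSpace ℝ (Fin d)) × (EuclideanSpace ℝ (Fin d) →L[ℝ] EuclideanSpace ℝ (Fin d)) → ℝ := fun p => ∑ w ∈ S, ‖p.1 * Φ (listProd A w) * p.2‖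
  let K : Set ((EuclideanSpace ℝ (Fin d) →L[ℝ] EuclideanSpace ℝ (Fin d)) × (EuclideanSpace ℝ (Fin d) →L[ℝ] EuclideanSpace ℝ (Fin d))) := Metric.sphere 0 1 ×ˢ Metric.sphere 0 1
  have hK : IsCompact K := (isCompact_sphere _ _).prod (isCompact_sphere _ _)
  have hF : Continuous F := by fun_prop
  have hpos : ∀ p ∈ K, 0 < F p := by
    rintro ⟨T₁, T₂⟩ ⟨h1, h2⟩
    have e1 : T₁ ≠ 0 := by rintro rfl; simp at h1
    have e2 : T₂ ≠ 0 := by rintro rfl; simp at h2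
    obtain ⟨w, hw, hne⟩ := exists_ne_zero hd A hA (Φ.symm T₁) (Φ.symm T₂)
      (by simpa using e1) (by simpa using e2)
    refine Finset.sum_pos' (fun _ _ => norm_nonneg _) ⟨w, (hS w).2 hw, ?_⟩
    rw [norm_pos_iff]
    intro h0
    apply hne
    have h3 : Φ (Φ.symm T₁ * listProd A w * Φ.symm T₂) = Φ 0 := by
      rw [map_mul, map_mul, map_zero, Φ.apply_symm_apply, Φ.apply_symm_apply]
      exact h0
    exact Φ.injective h3
  obtain ⟨c, hc, hcF⟩ : ∃ c : ℝ, 0 < c ∧ ∀ p ∈ K, c ≤ F p := by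
    rcases K.eq_empty_or_nonempty with h | h
    · exact ⟨1, one_pos, by simp [h]⟩
    · obtain ⟨p, hp, hmin⟩ := hK.exists_isMinOn h hF.continuousOn
      exact ⟨F p, hpos p hp, fun q hq => hmin hq⟩
  have hcard : (0 : ℝ) < S.card := by exact_mod_cast hSne.card_pos
  refine ⟨c / S.card, by positivity, fun B₁ B₂ => ?_⟩
  by_cases h1 : Φ B₁ = 0
  · refine ⟨[], by simp; omega, ?_⟩
    have : opNorm B₁ = 0 := by change ‖Φ B₁‖ = 0; simp [h1]
    rw [this]
    simp [opNorm]
  by_cases h2 : Φ B₂ = 0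
  · refine ⟨[], by simp; omega, ?_⟩
    have : opNorm B₂ = 0 := by change ‖Φ B₂‖ = 0; simp [h2]
    rw [this]
    simp [opNorm]
  have n1 : 0 < ‖Φ B₁‖ := norm_pos_iff.2 h1
  have n2 : 0 < ‖Φ B₂‖ := norm_pos_iff.2 h2
  have key := hcF (‖Φ B₁‖⁻¹ • Φ B₁, ‖Φ B₂‖⁻¹ • Φ B₂) (by
    constructor
    · exact mem_sphere_zero_iff_norm.2 (norm_normalize _ h1)
    · exact mem_sphere_zero_iff_norm.2 (norm_normalize _ h2))
  obtain ⟨w, hw, hle⟩ := Finset.exists_le_of_sum_le (s := S) (f := fun _ => c / S.card)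
    (g := fun w => ‖(‖Φ B₁‖⁻¹ • Φ B₁) * Φ (listProd A w) * (‖Φ B₂‖⁻¹ • Φ B₂)‖) hSne (by
      rw [Finset.sum_const, nsmul_eq_mul, mul_div_cancel₀ _ hcard.ne']
      exact key)
  refine ⟨w, (hS w).1 hw, ?_⟩
  change c / S.card * (‖Φ B₁‖ * ‖Φ B₂‖) ≤ ‖Φ (B₁ * listProd A w * B₂)‖
  rw [map_mul, map_mul]
  have hle := hle.trans_eq (norm_smul_mul_smul ‖Φ B₁‖⁻¹ ‖Φ B₂‖⁻¹ (by positivity) (by positivity)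
    (Φ B₁) (Φ (listProd A w)) (Φ B₂))
  calc _ ≤ _ := mul_le_mul_of_nonneg_right hle (by positivity)
    _ = _ := by field_simp
end

section
/- Let M ≥ 2 and let μ be a σ-invariant Borel probability measure on Σ_M which is totally ergodic (σ^k is ergodic with respect to μ for every k ≥ 1). Suppose there exists a constant K > 0 such that limsup_{n→∞} μ(X ∩ σ^{−n}Y) ≤ K μ(X) μ(Y) for every pair of Borel sets X, Y ⊆ Σ_M. Then μ is mixing: for all Borel sets X, Y ⊆ Σ_M, μ(X ∩ σ^{−n}Y) → μ(X)μ(Y) as n → ∞. -/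
open MeasureTheory Filter Topology

/-- Weak operator limit along an ultrafilter. -/
lemma ow_exists_weakLimit {H : Type*} [NormedAddCommGroup H] [InnerProductSpace ℝ H]
    [CompleteSpace H] (V : ℕ → H →ₗ[ℝ] H) (hV : ∀ n x, ‖V n x‖ ≤ ‖x‖) (u : Ultrafilter ℕ) :
    ∃ P : H →L[ℝ] H, ∀ x y,
      Tendsto (fun n => inner ℝ (V n x) y) u (𝓝 (inner ℝ (P x) y)) := by
  have hb : ∀ x y n, |inner ℝ (V n x) y| ≤ ‖x‖ * ‖y‖ := fun x y n =>
    (abs_real_inner_le_norm _ _).trans (by gcongr; exact hV n x)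
  have hex : ∀ x y, ∃ l : ℝ, |l| ≤ ‖x‖ * ‖y‖ ∧
      Tendsto (fun n => inner ℝ (V n x) y) u (𝓝 l) := by
    intro x y
    have hc : IsCompact (Set.Icc (-(‖x‖ * ‖y‖)) (‖x‖ * ‖y‖)) := isCompact_Icc
    obtain ⟨l, hl, hle⟩ := hc.ultrafilter_le_nhds (u.map (fun n => inner ℝ (V n x) y)) (by
      rw [le_principal_iff]
      exact Ultrafilter.mem_map.2 (Filter.univ_mem' fun n => abs_le.1 (hb x y n)))
    exact ⟨l, abs_le.2 hl, hle⟩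
  choose B hB1 hB using hex
  let L : H →ₗ[ℝ] H →ₗ[ℝ] ℝ := LinearMap.mk₂ ℝ B
    (fun a b c => tendsto_nhds_unique (hB (a + b) c)
      (((hB a c).add (hB b c)).congr fun n => by rw [map_add, inner_add_left]))
    (fun r a c => tendsto_nhds_unique (hB (r • a) c)
      (((hB a c).const_mul r).congr fun n => by rw [map_smul, real_inner_smul_left]))
    (fun a b c => tendsto_nhds_unique (hB a (b + c))
      (((hB a b).add (hB a c)).congr fun n => by rw [inner_add_right]))
    (fun r a c => tendsto_nhds_unique (hB a (r • c))
      (((hB a c).const_mul r).congr fun n => by rw [real_inner_smul_right]))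
  let L' : H →L[ℝ] H →L[ℝ] ℝ := L.mkContinuous₂ 1 (fun x y => by
    simpa [L] using hB1 x y)
  refine ⟨InnerProductSpace.continuousLinearMapOfBilin (𝕜 := ℝ) L', fun x y => ?_⟩
  rw [InnerProductSpace.continuousLinearMapOfBilin_apply]
  exact hB x y

/-- Hilbert-Schmidt type bound implies weak to strong continuity. -/
lemma ow_weak_strong {H : Type*} [NormedAddCommGroup H] [InnerProductSpace ℝ H]
    (P : H →L[ℝ] H) (C : ℝ)
    (hP : ∀ (m : ℕ) (e : Fin m → H), Orthonormal ℝ e → ∑ i, ‖P (e i)‖ ^ 2 ≤ C)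
    (l : Filter ℕ) (x : ℕ → H) (R : ℝ) (hR : ∀ n, ‖x n‖ ≤ R)
    (hx : ∀ y, Tendsto (fun n => inner ℝ (x n) y) l (𝓝 0)) :
    Tendsto (fun n => P (x n)) l (𝓝 0) := by
  have hR0 : 0 ≤ R := (norm_nonneg _).trans (hR 0)
  let S : Set ℝ := {s | ∃ (m : ℕ) (e : Fin m → H), Orthonormal ℝ e ∧ s = ∑ i, ‖P (e i)‖ ^ 2}
  have hSb : BddAbove S := ⟨C, by rintro _ ⟨m, e, he, rfl⟩; exact hP m e he⟩
  have hSn : S.Nonempty := ⟨_, 0, Fin.elim0, by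
    constructor
    · intro i; exact i.elim0
    · intro i; exact i.elim0, rfl⟩
  rw [tendsto_zero_iff_norm_tendsto_zero]
  rw [Metric.tendsto_nhds]
  intro ε hε
  set δ : ℝ := ε / (2 * (R + 1)) with hδ
  have hδ0 : 0 < δ := by positivity
  obtain ⟨_, ⟨m, e, he, rfl⟩, hs⟩ := exists_lt_of_lt_csSup hSn
    (show sSup S - δ ^ 2 < sSup S by nlinarith [pow_pos hδ0 2])
  -- vectors orthogonal to `e`
  have key : ∀ z : H, (∀ i, inner ℝ (e i) z = 0) → ‖P z‖ ≤ δ * ‖z‖ := by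
    intro z hz
    by_cases hz0 : z = 0
    · simp [hz0]
    have hzn : 0 < ‖z‖ := norm_pos_iff.2 hz0
    let w : H := ‖z‖⁻¹ • z
    have hw : ‖w‖ = 1 := by simp [w, norm_smul, hzn.ne']
    have hwe : ∀ i, inner ℝ (e i) w = 0 := fun i => by simp [w, real_inner_smul_right, hz i]
    have ho : Orthonormal ℝ (Fin.cons w e : Fin (m + 1) → H) := by
      constructor
      · intro i
        refine Fin.cases ?_ (fun j => ?_) i
        · simpa using hw
        · simpa using he.1 j
      · intro i j hij
        induction i using Fin.cases with
        | zero =>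
          induction j using Fin.cases with
          | zero => exact absurd rfl hij
          | succ j => simpa [real_inner_comm] using hwe j
        | succ i =>
          induction j using Fin.cases with
          | zero => simpa using hwe i
          | succ j => simpa using he.2 (fun h => hij (by rw [h]))
    have h1 := le_csSup hSb (show _ ∈ S from ⟨m + 1, _, ho, rfl⟩)
    rw [Fin.sum_univ_succ] at h1
    simp only [Fin.cons_zero, Fin.cons_succ] at h1
    have h2 : ‖P w‖ ^ 2 ≤ δ ^ 2 := by linarith
    have h3 : ‖P w‖ ≤ δ := abs_le_of_sq_le_sq' h2 hδ0.le |>.2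
    have h4 : z = ‖z‖ • w := by simp [w, smul_smul, hzn.ne']
    calc ‖P z‖ = ‖z‖ * ‖P w‖ := by
          conv_lhs => rw [h4]
          rw [map_smul, norm_smul, norm_norm]
      _ ≤ δ * ‖z‖ := by rw [mul_comm]; gcongr
  let F : ℕ → H := fun n => ∑ i, inner ℝ (e i) (x n) • e i
  have hF : Tendsto F l (𝓝 0) := by
    have : Tendsto F l (𝓝 (∑ i : Fin m, (0 : ℝ) • e i)) := by
      refine tendsto_finsetSum _ fun i _ => ?_
      refine Tendsto.smul_const ?_ _
      simpa [real_inner_comm] using hx (e i)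
    simpa using this
  have hPF : Tendsto (fun n => ‖P (F n)‖ + δ * ‖F n‖) l (𝓝 0) := by
    have h1 := ((P.continuous.tendsto 0).comp hF).norm
    have h2 := hF.norm.const_mul δ
    simpa using h1.add h2
  filter_upwards [(tendsto_order.1 hPF).2 (ε / 2) (by positivity)] with n hn
  have horth : ∀ i, inner ℝ (e i) (x n - F n) = 0 := by
    intro i
    rw [inner_sub_right, he.inner_right_fintype, sub_self]
  have h1 := key _ horth
  have h2 : ‖P (x n)‖ ≤ ‖P (F n)‖ + ‖P (x n - F n)‖ := by
    rw [map_sub]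
    simpa using norm_add_le (P (F n)) (P (x n) - P (F n))
  have h3 : ‖x n - F n‖ ≤ R + ‖F n‖ := (norm_sub_le _ _).trans (by gcongr; exact hR n)
  have h4 : δ * ‖x n - F n‖ ≤ δ * (R + ‖F n‖) := by gcongr
  have h5 : δ * R ≤ ε / 2 := by
    rw [hδ, div_mul_eq_mul_div, div_le_div_iff₀ (by positivity) (by norm_num)]
    nlinarith
  rw [Real.dist_eq, sub_zero, abs_norm]
  nlinarith

/-- Recurrence of vectors in the range of `P`. -/
lemma ow_recurrent {H : Type*} [NormedAddCommGroup H] [InnerProductSpace ℝ H]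
    [CompleteSpace H] (U : H →ₗᵢ[ℝ] H) (u : Ultrafilter ℕ) (hu : (u : Filter ℕ) ≤ atTop)
    (P : H →L[ℝ] H) (C : ℝ)
    (hP : ∀ (m : ℕ) (e : Fin m → H), Orthonormal ℝ e → ∑ i, ‖P (e i)‖ ^ 2 ≤ C)
    (hlim : ∀ x y, Tendsto (fun n => inner ℝ ((U ^ n) x) y) u (𝓝 (inner ℝ (P x) y)))
    (g : H) : ∃ l : Filter ℕ, l.NeBot ∧ l ≤ atTop ∧
      Tendsto (fun n => (U ^ n) (P g)) l (𝓝 (P g)) := by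
  have hcomm1 : ∀ x, P (U x) = U (P x) := by
    intro x
    refine ext_inner_right ℝ fun v => ?_
    let U' : H →L[ℝ] H := U.toContinuousLinearMap
    have e : ∀ a, inner ℝ (U a) v = inner ℝ a (ContinuousLinearMap.adjoint U' v) := by
      intro a
      rw [ContinuousLinearMap.adjoint_inner_right]
      rfl
    refine tendsto_nhds_unique (hlim (U x) v) ?_
    rw [e]
    refine (hlim x _).congr fun n => ?_
    rw [← e]
    congr 1
    change (U * U ^ n) x = (U ^ n * U) x
    rw [← pow_succ', ← pow_succ]
  have hcomm : ∀ n x, P ((U ^ n) x) = (U ^ n) (P x) := by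
    intro n
    induction n with
    | zero => intro x; rfl
    | succ n ih =>
      intro x
      rw [pow_succ]
      change P ((U ^ n) (U x)) = (U ^ n) (U (P x))
      rw [ih, hcomm1]
  have h1 : Tendsto (fun n => P ((U ^ n) g - P g)) u (𝓝 0) := by
    refine ow_weak_strong P C hP u _ (‖g‖ + ‖P g‖) (fun n => ?_) (fun y => ?_)
    · exact (norm_sub_le _ _).trans (by rw [LinearIsometry.norm_map])
    · have := (hlim g y).sub_const (inner ℝ (P g) y)
      simpa [inner_sub_left] using this
  have h2 : Tendsto (fun n => (U ^ n) (P g)) u (𝓝 (P (P g))) := by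
    have := h1.add_const (P (P g))
    simpa [hcomm] using this
  refine ⟨atTop ⊓ comap (fun n => (U ^ n) (P g)) (𝓝 (P g)), ?_, inf_le_left, ?_⟩
  · rw [inf_neBot_iff]
    intro s hs t ht
    obtain ⟨N, hN⟩ := mem_atTop_sets.1 hs
    obtain ⟨V, hV, hVt⟩ := mem_comap.1 ht
    obtain ⟨ε, hε, hball⟩ := Metric.mem_nhds_iff.1 hV
    have hev : ∀ᶠ n in (u : Filter ℕ), dist ((U ^ n) (P g)) (P (P g)) < ε / 2 :=
      Metric.tendsto_nhds.1 h2 _ (half_pos hε)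
    obtain ⟨n, hn⟩ := hev.exists
    obtain ⟨n', hn', hge⟩ := (hev.and (hu (eventually_ge_atTop (n + N)))).exists
    obtain ⟨k, rfl⟩ := Nat.exists_eq_add_of_le hge
    refine ⟨N + k, hN _ (by omega), hVt (hball ?_)⟩
    rw [Metric.mem_ball]
    have h3 : dist ((U ^ (N + k)) (P g)) (P g) =
        dist ((U ^ (n + N + k)) (P g)) ((U ^ n) (P g)) := by
      rw [add_assoc, pow_add U n]
      exact ((U ^ n).dist_map _ _).symm
    rw [h3]
    calc _ ≤ _ := dist_triangle_right _ _ (P (P g))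
      _ < ε / 2 + ε / 2 := add_lt_add hn' hn
      _ = ε := add_halves ε
  · exact tendsto_comap.mono_left inf_le_right

section
set_option linter.unusedSectionVars false
variable {Ω : Type*} [MeasurableSpace Ω] {μ : Measure Ω} [IsProbabilityMeasure μ] {T : Ω → Ω}

/-- Sets which are rigid along a filter. -/
def owRigid (μ : Measure Ω) (T : Ω → Ω) (l : Filter ℕ) (X : Set Ω) : Prop :=
  MeasurableSet X ∧ Tendsto (fun n => μ (symmDiff X (T^[n] ⁻¹' X))) l (𝓝 0)

lemma owRigid.inter {l : Filter ℕ} {X Y : Set Ω} (hX : owRigid μ T l X) (hY : owRigid μ T l Y) :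
    owRigid μ T l (X ∩ Y) := by
  refine ⟨hX.1.inter hY.1, ?_⟩
  have h := hX.2.add hY.2
  rw [add_zero] at h
  refine tendsto_of_tendsto_of_tendsto_of_le_of_le tendsto_const_nhds h (fun _ => zero_le) ?_
  intro n
  refine (measure_mono ?_).trans (measure_union_le _ _)
  intro x
  simp only [Set.mem_symmDiff, Set.mem_inter_iff, Set.mem_preimage, Set.mem_union]
  tauto

lemma owRigid.compl {l : Filter ℕ} {X : Set Ω} (hX : owRigid μ T l X) :
    owRigid μ T l Xᶜ := by
  refine ⟨hX.1.compl, ?_⟩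
  refine hX.2.congr fun n => ?_
  congr 1
  ext x
  simp only [Set.mem_symmDiff, Set.mem_compl_iff, Set.mem_preimage]
  tauto

lemma owRigid.preimage {l : Filter ℕ} {X : Set Ω} (hT : MeasurePreserving T μ μ)
    (hX : owRigid μ T l X) (k : ℕ) : owRigid μ T l (T^[k] ⁻¹' X) := by
  refine ⟨(hT.iterate k).measurable hX.1, ?_⟩
  refine hX.2.congr fun n => ?_
  rw [← (hT.iterate k).measure_preimage (hX.1.symmDiff ((hT.iterate n).measurable hX.1)).nullMeasurableSet]
  congr 1
  ext x
  simp only [Set.mem_symmDiff, Set.mem_preimage]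
  rw [← Function.iterate_add_apply, ← Function.iterate_add_apply, add_comm]

lemma ow_rigid_trivial (hT : MeasurePreserving T μ μ)
    (herg : ∀ k : ℕ, 1 ≤ k → Ergodic T^[k] μ)
    (K : ℝ) (hK : 0 < K)
    (hls : ∀ X Y : Set Ω, MeasurableSet X → MeasurableSet Y →
      limsup (fun n : ℕ => μ (X ∩ T^[n] ⁻¹' Y)) atTop ≤ ENNReal.ofReal K * (μ X * μ Y))
    {l : Filter ℕ} [l.NeBot] (hl : l ≤ atTop) {Y : Set Ω} (hY : owRigid μ T l Y)
    (hpos : μ Y ≠ 0) : μ Y = 1 := by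
  by_contra hne
  have hY0 : 0 < μ.real Y := ENNReal.toReal_pos hpos (measure_ne_top _ _)
  have hY1 : μ.real Y < 1 := by
    have h : μ Y < 1 := lt_of_le_of_ne prob_le_one hne
    have := (ENNReal.toReal_lt_toReal (measure_ne_top _ _) ENNReal.one_ne_top).2 h
    rwa [ENNReal.toReal_one] at this
  -- lower bound of the measure of rigid sets
  have hlow : ∀ X, owRigid μ T l X → 0 < μ.real X → K⁻¹ ≤ μ.real X := by
    intro X hX hX0
    have h1 : μ X ≤ ENNReal.ofReal K * (μ X * μ X) := by
      refine le_of_forall_gt fun c hc => ?_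
      obtain ⟨d, hd, hdc⟩ := exists_between hc
      have e1 : ∀ᶠ n in l, μ (X ∩ T^[n] ⁻¹' X) < d :=
        hl (eventually_lt_of_limsup_lt (lt_of_le_of_lt (hls X X hX.1 hX.1) hd))
      have e2 : ∀ᶠ n in l, μ (symmDiff X (T^[n] ⁻¹' X)) < c - d :=
        (tendsto_order.1 hX.2).2 _ (tsub_pos_of_lt hdc)
      obtain ⟨n, hn1, hn2⟩ := (e1.and e2).exists
      calc μ X ≤ μ (X ∩ T^[n] ⁻¹' X) + μ (symmDiff X (T^[n] ⁻¹' X)) := by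
            refine (measure_mono ?_).trans (measure_union_le _ _)
            intro x
            simp only [Set.mem_symmDiff, Set.mem_inter_iff, Set.mem_preimage, Set.mem_union]
            tauto
        _ < d + (c - d) := ENNReal.add_lt_add hn1 hn2
        _ = c := add_tsub_cancel_of_le hdc.le
    have h2 := ENNReal.toReal_mono (by finiteness) h1
    rw [ENNReal.toReal_mul, ENNReal.toReal_mul, ENNReal.toReal_ofReal hK.le] at h2
    change μ.real X ≤ K * (μ.real X * μ.real X) at h2
    rw [inv_le_iff_one_le_mul₀ hK]
    nlinarith
  let S : Set ℝ := {r | ∃ X, owRigid μ T l X ∧ 0 < μ.real X ∧ r = μ.real X}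
  have hSY : μ.real Y ∈ S := ⟨Y, hY, hY0, rfl⟩
  have hSb : BddBelow S := ⟨K⁻¹, by rintro _ ⟨X, h1, h2, rfl⟩; exact hlow X h1 h2⟩
  set a := sInf S with ha
  have ha0 : 0 < a := lt_of_lt_of_le (inv_pos.2 hK)
    (le_csInf ⟨_, hSY⟩ (by rintro _ ⟨X, h1, h2, rfl⟩; exact hlow X h1 h2))
  have ha1 : a < 1 := lt_of_le_of_lt (csInf_le hSb hSY) hY1
  obtain ⟨_, ⟨X, hX, hX0, rfl⟩, hXa⟩ := exists_lt_of_csInf_lt ⟨_, hSY⟩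
    (show sInf S < min (2 * a) 1 from lt_min (by linarith) ha1)
  obtain ⟨k, hk, hk0⟩ := hT.conservative.exists_gt_measure_inter_ne_zero
    hX.1.nullMeasurableSet (s := X) (fun h => by simp [Measure.real, h] at hX0) 0
  have hI : owRigid μ T l (X ∩ T^[k] ⁻¹' X) := hX.inter (hX.preimage hT k)
  have hD : owRigid μ T l (X ∩ (T^[k] ⁻¹' X)ᶜ) := hX.inter (hX.preimage hT k).compl
  have hIa : a ≤ μ.real (X ∩ T^[k] ⁻¹' X) :=
    csInf_le hSb ⟨_, hI, ENNReal.toReal_pos hk0 (measure_ne_top _ _), rfl⟩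
  have hsum : μ.real (X ∩ T^[k] ⁻¹' X) + μ.real (X ∩ (T^[k] ⁻¹' X)ᶜ) = μ.real X := by
    rw [← Set.sdiff_eq]
    exact measureReal_inter_add_sdiff ((hT.iterate k).measurable hX.1)
  have hD0 : μ (X \ T^[k] ⁻¹' X) = 0 := by
    by_contra h
    rw [Set.sdiff_eq] at h
    have : a ≤ μ.real (X ∩ (T^[k] ⁻¹' X)ᶜ) :=
      csInf_le hSb ⟨_, hD, ENNReal.toReal_pos h (measure_ne_top _ _), rfl⟩
    linarith [lt_min_iff.1 hXa]
  rcases (herg k hk).ae_empty_or_univ_of_ae_le_preimage hX.1.nullMeasurableSet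
    (ae_le_set.2 hD0) with h | h
  · rw [measureReal_congr h] at hX0; simp at hX0
  · rw [measureReal_congr h] at hXa; simp at hXa

/-- A recurrent function is constant. -/
lemma ow_const (hT : MeasurePreserving T μ μ)
    (herg : ∀ k : ℕ, 1 ≤ k → Ergodic T^[k] μ)
    (K : ℝ) (hK : 0 < K)
    (hls : ∀ X Y : Set Ω, MeasurableSet X → MeasurableSet Y →
      limsup (fun n : ℕ => μ (X ∩ T^[n] ⁻¹' Y)) atTop ≤ ENNReal.ofReal K * (μ X * μ Y))
    {l : Filter ℕ} [l.NeBot] (hl : l ≤ atTop) (f : Ω → ℝ) (hfm : Measurable f)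
    (hfi : Integrable f μ)
    (hf : TendstoInMeasure μ (fun n => f ∘ T^[n]) l f) : f =ᵐ[μ] fun _ => ∫ x, f x ∂μ := by
  set c₀ := ∫ x, f x ∂μ with hc₀
  have hrig : ∀ c, μ {x | f x = c} = 0 → owRigid μ T l {x | c < f x} := by
    intro c hc
    refine ⟨measurableSet_lt measurable_const hfm, ?_⟩
    have hsm : Tendsto (fun n : ℕ => μ {x | |f x - c| ≤ 1 / ((n : ℝ) + 1)}) atTop (𝓝 0) := by
      have := tendsto_measure_iInter_atTop (μ := μ)
        (s := fun n : ℕ => {x | |f x - c| ≤ 1 / ((n : ℝ) + 1)})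
        (fun n => (measurableSet_le (hfm.sub_const c).abs measurable_const).nullMeasurableSet)
        (fun m n hmn x hx => le_trans (show |f x - c| ≤ _ from hx) (by gcongr))
        ⟨0, measure_ne_top _ _⟩
      have h0 : (⋂ n : ℕ, {x | |f x - c| ≤ 1 / ((n : ℝ) + 1)}) = {x | f x = c} := by
        ext x
        simp only [Set.mem_iInter, Set.mem_ofPred_eq]
        constructor
        · intro h
          have : |f x - c| ≤ 0 := ge_of_tendsto' tendsto_one_div_add_atTop_nhds_zero_nat h
          linarith [abs_nonpos_iff.1 this]
        · intro h n
          rw [h, sub_self, abs_zero]; positivity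
      rwa [h0, hc] at this
    rw [ENNReal.tendsto_nhds_zero]
    intro ε hε
    obtain ⟨N, hN⟩ := ((tendsto_order.1 hsm).2 (ε / 2) (ENNReal.half_pos hε.ne')).exists
    have hδ : (0 : ℝ) < 1 / ((N : ℝ) + 1) := by positivity
    have h2 := (tendsto_order.1 (tendstoInMeasure_iff_norm.1 hf _ hδ)).2 (ε / 2)
      (ENNReal.half_pos hε.ne')
    filter_upwards [h2] with n hn
    calc _ ≤ μ {x | |f x - c| ≤ 1 / ((N : ℝ) + 1)} +
          μ {x | 1 / ((N : ℝ) + 1) ≤ ‖(f ∘ T^[n]) x - f x‖} := by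
          refine (measure_mono ?_).trans (measure_union_le _ _)
          intro x hx
          simp only [Set.mem_symmDiff, Set.mem_preimage, Set.mem_ofPred_eq, not_lt] at hx
          simp only [Set.mem_union, Set.mem_ofPred_eq, Function.comp, Real.norm_eq_abs]
          by_contra! h
          obtain ⟨h3, h4⟩ := h
          rw [abs_lt] at h4
          rw [lt_abs] at h3
          rcases hx with hx | hx <;> rcases h3 with h3 | h3 <;> linarith
      _ ≤ ε / 2 + ε / 2 := by gcongr
      _ = ε := ENNReal.add_halves ε
  have hle : ∀ᵐ x ∂μ, f x ≤ c₀ := by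
    by_contra hcon
    have hcon' : μ {x | c₀ < f x} ≠ 0 := by
      intro h
      apply hcon
      rw [ae_iff]
      simpa using h
    have hun : {x | c₀ < f x} = ⋃ n : ℕ, {x | c₀ + 1 / ((n : ℝ) + 1) < f x} := by
      ext x
      simp only [Set.mem_iUnion, Set.mem_ofPred_eq]
      constructor
      · intro h
        obtain ⟨n, hn⟩ := exists_nat_one_div_lt (sub_pos.2 h)
        exact ⟨n, by linarith⟩
      · rintro ⟨n, hn⟩
        have : (0 : ℝ) < 1 / ((n : ℝ) + 1) := by positivity
        linarith
    rw [hun] at hcon'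
    obtain ⟨n, hn⟩ : ∃ n : ℕ, μ {x | c₀ + 1 / ((n : ℝ) + 1) < f x} ≠ 0 := by
      by_contra! h
      exact hcon' (measure_iUnion_null h)
    have hcount : Set.Countable {c : ℝ | 0 < μ {x | f x = c}} :=
      Measure.countable_meas_level_set_pos hfm
    obtain ⟨c, hc1, hc2⟩ : ∃ c ∈ Set.Ioo c₀ (c₀ + 1 / ((n : ℝ) + 1)), μ {x | f x = c} = 0 := by
      by_contra! h
      have hs : Set.Ioo c₀ (c₀ + 1 / ((n : ℝ) + 1)) ⊆ {c : ℝ | 0 < μ {x | f x = c}} :=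
        fun c hc => pos_iff_ne_zero.2 (h c hc)
      exact (Cardinal.Real.Ioo_countable_iff.1 (hcount.mono hs)).not_gt
        (by have : (0 : ℝ) < 1 / ((n : ℝ) + 1) := by positivity
            linarith)
    have h1 : μ {x | c < f x} = 1 := by
      refine ow_rigid_trivial hT herg K hK hls hl (hrig c hc2) ?_
      intro h
      exact hn (measure_mono_null (fun x hx => hc1.2.trans hx) h)
    have h2 : ∀ᵐ x ∂μ, c < f x := by
      rw [← prob_compl_eq_zero_iff (measurableSet_lt measurable_const hfm)] at h1
      exact h1
    have h3 : ∫ _, c ∂μ ≤ ∫ x, f x ∂μ :=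
      integral_mono_ae (integrable_const c) hfi (h2.mono fun x hx => hx.le)
    simp at h3
    linarith [hc1.1]
  have h0 : ∫ x, (c₀ - f x) ∂μ = 0 := by
    rw [integral_sub (integrable_const _) hfi]
    simp [hc₀]
  have h1 := (integral_eq_zero_iff_of_nonneg_ae (hle.mono fun x hx => sub_nonneg.2 hx)
    ((integrable_const _).sub hfi)).1 h0
  filter_upwards [h1] with x hx
  simp at hx
  linarith

end

section
set_option linter.unusedSectionVars false
variable {Ω : Type*} [MeasurableSpace Ω] {μ : Measure Ω} [IsProbabilityMeasure μ] {T : Ω → Ω}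

/-- Indicator as an `L²` element. -/
noncomputable def owInd (μ : Measure Ω) [IsProbabilityMeasure μ] {X : Set Ω}
    (hX : MeasurableSet X) : Lp ℝ 2 μ :=
  indicatorConstLp 2 hX (measure_ne_top μ X) 1

lemma owInd_coe {X : Set Ω} (hX : MeasurableSet X) :
    (owInd μ hX : Ω → ℝ) =ᵐ[μ] X.indicator (fun _ => 1) := indicatorConstLp_coeFn

lemma owInner_eq (f g : Lp ℝ 2 μ) : inner ℝ f g = ∫ x, f x * g x ∂μ := by
  rw [L2.inner_def]
  simp [mul_comm]

lemma owInner_ind (f : Lp ℝ 2 μ) {X : Set Ω} (hX : MeasurableSet X) :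
    inner ℝ f (owInd μ hX) = ∫ x in X, f x ∂μ := by
  rw [owInner_eq, ← integral_indicator hX]
  refine integral_congr_ae ?_
  filter_upwards [owInd_coe (μ := μ) hX] with x hx
  rw [hx]
  by_cases h : x ∈ X <;> simp [h]


/-- The `L¹`-`L¹` bound of the weak limit operator. -/
lemma ow_bound (P : Lp ℝ 2 μ →L[ℝ] Lp ℝ 2 μ) (K : ℝ) {X : Set Ω} (hX : MeasurableSet X)
    (hP : ∀ (Y : Set Ω) (hY : MeasurableSet Y),
      |inner ℝ (P (owInd μ hY)) (owInd μ hX)| ≤ K * μ.real X * μ.real Y) (g : Lp ℝ 2 μ) :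
    |inner ℝ (P g) (owInd μ hX)| ≤ K * μ.real X *
      inner ℝ (|g|) (owInd μ (MeasurableSet.univ (α := Ω))) := by
  have hint : ∀ g : Lp ℝ 2 μ, inner ℝ (|g|) (owInd μ (MeasurableSet.univ (α := Ω))) =
      ∫ x, |g x| ∂μ := by
    intro g
    rw [owInner_ind, Measure.restrict_univ]
    exact integral_congr_ae (Lp.coeFn_abs g)
  induction g using Lp.induction (p := 2) (hp_ne_top := ENNReal.ofNat_ne_top) with
  | indicatorConst c hs hμs =>
    rename_i s
    have h1 : (↑(Lp.simpleFunc.indicatorConst 2 hs hμs.ne c) : Lp ℝ 2 μ) = c • owInd μ hs := by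
      rw [Lp.simpleFunc.coe_indicatorConst]
      unfold owInd
      refine Lp.ext ?_
      filter_upwards [Lp.coeFn_smul c (indicatorConstLp 2 hs hμs.ne (1 : ℝ)),
        indicatorConstLp_coeFn (p := 2) (hs := hs) (hμs := hμs.ne) (c := c),
        indicatorConstLp_coeFn (p := 2) (hs := hs) (hμs := hμs.ne) (c := (1 : ℝ))] with x h1 h2 h3
      rw [h1, h2, Pi.smul_apply, h3]
      by_cases h : x ∈ s <;> simp [h]
    rw [h1, hint, map_smul, real_inner_smul_left, abs_mul]
    have h2 : ∫ x, |(c • owInd μ hs : Lp ℝ 2 μ) x| ∂μ = |c| * μ.real s := by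
      have : ∫ x, |(c • owInd μ hs : Lp ℝ 2 μ) x| ∂μ = ∫ x, s.indicator (fun _ => |c|) x ∂μ := by
        refine integral_congr_ae ?_
        filter_upwards [Lp.coeFn_smul c (owInd μ hs), owInd_coe (μ := μ) hs] with x h3 h4
        rw [h3, Pi.smul_apply, h4]
        by_cases h : x ∈ s <;> simp [h]
      rw [this, integral_indicator hs]
      simp [mul_comm]
    rw [h2]
    have := mul_le_mul_of_nonneg_left (hP s hs) (abs_nonneg c)
    linarith
  | add hf hg hd h1 h2 =>
    rename_i f g
    have h3 : inner ℝ (|hf.toLp f + hg.toLp g|) (owInd μ (MeasurableSet.univ (α := Ω))) =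
        inner ℝ (|hf.toLp f|) (owInd μ (MeasurableSet.univ (α := Ω))) +
        inner ℝ (|hg.toLp g|) (owInd μ (MeasurableSet.univ (α := Ω))) := by
      rw [hint, hint, hint, ← integral_add]
      · refine integral_congr_ae ?_
        filter_upwards [Lp.coeFn_add (hf.toLp f) (hg.toLp g), hf.coeFn_toLp, hg.coeFn_toLp]
          with x e1 e2 e3
        rw [e1, Pi.add_apply, e2, e3]
        by_cases hx : f x = 0
        · simp [hx]
        · have : g x = 0 := by
            by_contra hgx
            exact Set.disjoint_left.1 hd (show x ∈ Function.support f from hx) hgx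
          simp [this]
      · exact ((Lp.memLp (hf.toLp f)).integrable (by norm_num)).abs
      · exact ((Lp.memLp (hg.toLp g)).integrable (by norm_num)).abs
    rw [h3, map_add, inner_add_left, mul_add]
    exact (abs_add_le _ _).trans (add_le_add h1 h2)
  | isClosed =>
    have habs : Continuous (fun g : Lp ℝ 2 μ => |g|) := by
      refine (LipschitzWith.of_dist_le_mul (K := 1) fun a b => ?_).continuous
      rw [dist_eq_norm, dist_eq_norm, NNReal.coe_one, one_mul]
      exact norm_abs_sub_abs a b
    refine isClosed_le ?_ ?_
    · exact ((P.continuous).inner continuous_const).abs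
    · exact continuous_const.mul (habs.inner continuous_const)

lemma ow_ae_bound (P : Lp ℝ 2 μ →L[ℝ] Lp ℝ 2 μ) (K : ℝ) (hK : 0 < K)
    (hP : ∀ (X Y : Set Ω) (hX : MeasurableSet X) (hY : MeasurableSet Y),
      |inner ℝ (P (owInd μ hY)) (owInd μ hX)| ≤ K * μ.real X * μ.real Y) (g : Lp ℝ 2 μ) :
    ∀ᵐ x ∂μ, P g x ≤ K * ‖g‖ := by
  refine ae_le_of_forall_setIntegral_le ((Lp.memLp (P g)).integrable (by norm_num))
    (integrable_const _) fun X hX _ => ?_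
  rw [← owInner_ind _ hX]
  have h1 := ow_bound P K hX (fun Y hY => hP X Y hX hY) g
  have h2 : inner ℝ (|g|) (owInd μ (MeasurableSet.univ (α := Ω))) ≤ ‖g‖ := by
    refine (real_inner_le_norm _ _).trans ?_
    rw [norm_abs_eq_norm]
    have : ‖owInd μ (MeasurableSet.univ (α := Ω))‖ = 1 := by
      unfold owInd
      rw [norm_indicatorConstLp (by norm_num) (by norm_num)]
      simp
    rw [this, mul_one]
  have h3 : ∫ _ in X, K * ‖g‖ ∂μ = K * μ.real X * ‖g‖ := by
    simp; ring
  rw [h3]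
  exact (le_abs_self _).trans (h1.trans (by gcongr))

lemma ow_hs (P : Lp ℝ 2 μ →L[ℝ] Lp ℝ 2 μ) (K : ℝ) (hK : 0 < K)
    (hP : ∀ g : Lp ℝ 2 μ, ∀ᵐ x ∂μ, P g x ≤ K * ‖g‖)
    (m : ℕ) (e : Fin m → Lp ℝ 2 μ) (he : Orthonormal ℝ e) : ∑ i, ‖P (e i)‖ ^ 2 ≤ K ^ 2 := by
  have hnorm : ∀ c : Fin m → ℝ, ‖∑ i, c i • e i‖ ^ 2 = ∑ i, c i ^ 2 := by
    intro c
    rw [← real_inner_self_eq_norm_sq, he.inner_sum]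
    simp [sq]
  have hcoe : ∀ c : Fin m → ℝ, ∀ᵐ x ∂μ, P (∑ i, c i • e i) x = ∑ i, c i * P (e i) x := by
    intro c
    rw [map_sum]
    have h1 := Lp.coeFn_finsetSum (p := 2) (μ := μ) Finset.univ (fun i => P (c i • e i))
    have h2 : ∀ᵐ x ∂μ, ∀ i, P (c i • e i) x = c i * P (e i) x := by
      rw [ae_all_iff]
      intro i
      rw [map_smul]
      filter_upwards [Lp.coeFn_smul (c i) (P (e i))] with x hx
      rw [hx]; rfl
    filter_upwards [h1, h2] with x h1 h2
    rw [h1, Finset.sum_apply]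
    exact Finset.sum_congr rfl fun i _ => h2 i
  obtain ⟨D, hDc, hDd⟩ := TopologicalSpace.exists_countable_dense (Fin m → ℝ)
  have hall : ∀ᵐ x ∂μ, ∀ c ∈ D, ∑ i, c i * P (e i) x ≤ K * ‖∑ i, c i • e i‖ := by
    rw [ae_ball_iff hDc]
    intro c _
    filter_upwards [hcoe c, hP (∑ i, c i • e i)] with x h1 h2
    rwa [← h1]
  have hpt : ∀ᵐ x ∂μ, ∑ i, (P (e i) x) ^ 2 ≤ K ^ 2 := by
    filter_upwards [hall] with x hx
    have hcl : IsClosed {c : Fin m → ℝ | ∑ i, c i * P (e i) x ≤ K * ‖∑ i, c i • e i‖} := by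
      refine isClosed_le ?_ ?_
      · fun_prop
      · fun_prop
    have hx' : ∀ c : Fin m → ℝ, ∑ i, c i * P (e i) x ≤ K * ‖∑ i, c i • e i‖ := fun c =>
      hcl.closure_subset_iff.2 hx (hDd c)
    have h1 := hx' (fun i => P (e i) x)
    have h2 := hnorm (fun i => P (e i) x)
    set r := ‖∑ i, (P (e i) x) • e i‖ with hr
    have hr0 : 0 ≤ r := norm_nonneg _
    have h3 : ∑ i, (P (e i) x) * (P (e i) x) = r ^ 2 := by
      rw [h2]; simp [sq]
    rw [h3] at h1
    rw [← h2]
    have h4 : r ≤ K := by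
      by_contra! h
      nlinarith
    gcongr
  have hn : ∀ i, ‖P (e i)‖ ^ 2 = ∫ x, (P (e i) x) ^ 2 ∂μ := by
    intro i
    rw [← real_inner_self_eq_norm_sq, owInner_eq]
    simp [sq]
  simp_rw [hn]
  have hi : ∀ i, Integrable (fun x => (P (e i) x) ^ 2) μ := fun i => (Lp.memLp (P (e i))).integrable_sq
  rw [← integral_finsetSum _ (fun i _ => hi i)]
  calc _ ≤ ∫ _, K ^ 2 ∂μ := integral_mono_ae (integrable_finsetSum _ fun i _ => hi i)
        (integrable_const _) hpt
    _ = K ^ 2 := by simp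

end

section
variable {Ω : Type*} [MeasurableSpace Ω] {μ : Measure Ω} [IsProbabilityMeasure μ] {T : Ω → Ω}

lemma ow_pow_coe (hT : MeasurePreserving T μ μ) (n : ℕ) (g : Lp ℝ 2 μ) :
    (((Lp.compMeasurePreservingₗᵢ ℝ T hT : Lp ℝ 2 μ →ₗᵢ[ℝ] Lp ℝ 2 μ) ^ n) g : Ω → ℝ)
      =ᵐ[μ] g ∘ T^[n] := by
  induction n generalizing g with
  | zero => exact Filter.EventuallyEq.rfl
  | succ n ih =>
    rw [pow_succ, Function.iterate_succ']
    refine (ih _).trans ?_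
    have h1 : (Lp.compMeasurePreserving T hT g : Ω → ℝ) =ᵐ[μ] g ∘ T :=
      Lp.coeFn_compMeasurePreserving g hT
    exact (hT.iterate n).quasiMeasurePreserving.ae_eq_comp h1

lemma ow_main (hT : MeasurePreserving T μ μ)
    (herg : ∀ k : ℕ, 1 ≤ k → Ergodic T^[k] μ)
    (K : ℝ) (hK : 0 < K)
    (hls : ∀ X Y : Set Ω, MeasurableSet X → MeasurableSet Y →
      limsup (fun n : ℕ => μ (X ∩ T^[n] ⁻¹' Y)) atTop ≤ ENNReal.ofReal K * (μ X * μ Y))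
    (X Y : Set Ω) (hX : MeasurableSet X) (hY : MeasurableSet Y) :
    Tendsto (fun n : ℕ => μ (X ∩ T^[n] ⁻¹' Y)) atTop (𝓝 (μ X * μ Y)) := by
  rw [tendsto_iff_ultrafilter]
  intro u hu
  let U : Lp ℝ 2 μ →ₗᵢ[ℝ] Lp ℝ 2 μ := Lp.compMeasurePreservingₗᵢ ℝ T hT
  obtain ⟨P, hlim⟩ := ow_exists_weakLimit (fun n => (U ^ n).toLinearMap)
    (fun n x => ((U ^ n).norm_map x).le) u
  replace hlim : ∀ x y, Tendsto (fun n => inner ℝ ((U ^ n) x) y) u (𝓝 (inner ℝ (P x) y)) := hlim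
  have hind : ∀ (X Y : Set Ω) (hX : MeasurableSet X) (hY : MeasurableSet Y) (n : ℕ),
      inner ℝ ((U ^ n) (owInd μ hY)) (owInd μ hX) = μ.real (X ∩ T^[n] ⁻¹' Y) := by
    intro X Y hX hY n
    have h1 : ∫ x in X, ((U ^ n) (owInd μ hY)) x ∂μ =
        ∫ x in X, (T^[n] ⁻¹' Y).indicator (fun _ => (1 : ℝ)) x ∂μ := by
      refine integral_congr_ae (ae_restrict_of_ae ?_)
      have h2 := (hT.iterate n).quasiMeasurePreserving.ae_eq_comp (owInd_coe (μ := μ) hY)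
      filter_upwards [ow_pow_coe hT n (owInd μ hY), h2] with x h3 h4
      rw [h3, h4]
      rfl
    rw [owInner_ind, h1, setIntegral_indicator ((hT.iterate n).measurable hY)]
    simp
  have hlimset : ∀ (X Y : Set Ω) (hX : MeasurableSet X) (hY : MeasurableSet Y),
      Tendsto (fun n => μ.real (X ∩ T^[n] ⁻¹' Y)) u
        (𝓝 (inner ℝ (P (owInd μ hY)) (owInd μ hX))) := fun X Y hX hY =>
    (hlim _ _).congr fun n => hind X Y hX hY n
  have hP : ∀ (X Y : Set Ω) (hX : MeasurableSet X) (hY : MeasurableSet Y),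
      |inner ℝ (P (owInd μ hY)) (owInd μ hX)| ≤ K * μ.real X * μ.real Y := by
    intro X Y hX hY
    rw [abs_of_nonneg (ge_of_tendsto' (hlimset X Y hX hY) fun n => measureReal_nonneg)]
    refine le_of_forall_gt_imp_ge_of_dense fun c hc => ?_
    refine le_of_tendsto (hlimset X Y hX hY) ?_
    have hc0 : 0 < c := lt_of_le_of_lt (by positivity) hc
    have h1 : ENNReal.ofReal K * (μ X * μ Y) < ENNReal.ofReal c := by
      rw [ENNReal.lt_ofReal_iff_toReal_lt (by finiteness), ENNReal.toReal_mul, ENNReal.toReal_mul,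
        ENNReal.toReal_ofReal hK.le, ← mul_assoc]
      exact hc
    have h2 := hu (eventually_lt_of_limsup_lt (lt_of_le_of_lt (hls X Y hX hY) h1))
    filter_upwards [h2] with n hn
    exact ENNReal.toReal_le_of_le_ofReal hc0.le hn.le
  obtain ⟨l, hl1, hl2, hl3⟩ := ow_recurrent U u hu P (K ^ 2)
    (fun m e he => ow_hs P K hK (ow_ae_bound P K hK hP) m e he) hlim (owInd μ hY)
  set f := P (owInd μ hY) with hf
  have hfm := (Lp.stronglyMeasurable f).measurable
  have hfi : Integrable f μ := (Lp.memLp f).integrable (by norm_num)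
  have hmeas : TendstoInMeasure μ (fun n => (f : Ω → ℝ) ∘ T^[n]) l f :=
    (tendstoInMeasure_of_tendsto_Lp hl3).congr_left fun n => ow_pow_coe hT n f
  have hconst := ow_const hT herg K hK hls hl2 f hfm hfi hmeas
  have hInt : ∫ x, f x ∂μ = μ.real Y := by
    have h1 := hlimset Set.univ Y MeasurableSet.univ hY
    rw [owInner_ind, Measure.restrict_univ] at h1
    refine tendsto_nhds_unique h1 (tendsto_const_nhds.congr fun n => ?_)
    rw [Set.univ_inter, measureReal_def, measureReal_def,
      (hT.iterate n).measure_preimage hY.nullMeasurableSet]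
  have hval : inner ℝ f (owInd μ hX) = μ.real X * μ.real Y := by
    rw [owInner_ind, setIntegral_congr_ae hX (hconst.mono fun x hx _ => hx), hInt]
    simp
  have h1 := hlimset X Y hX hY
  rw [← hf, hval] at h1
  have h2 := (ENNReal.tendsto_ofReal h1)
  rw [ENNReal.ofReal_mul measureReal_nonneg, ofReal_measureReal, ofReal_measureReal] at h2
  exact h2.congr fun n => ofReal_measureReal

end

/-- total ergodicity plus the limsup inequality implies mixing. -/
theorem stmt_4 {M : ℕ} (hM : 2 ≤ M)
    (μ : Measure (ℕ → Fin M)) [IsProbabilityMeasure μ]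
    (hinv : MeasurePreserving (shift (M := M)) μ μ)
    (herg : ∀ k : ℕ, 1 ≤ k → Ergodic (shift (M := M))^[k] μ)
    (K : ℝ) (hK : 0 < K)
    (hls : ∀ X Y : Set (ℕ → Fin M), MeasurableSet X → MeasurableSet Y →
      Filter.limsup (fun n : ℕ => μ (X ∩ shift^[n] ⁻¹' Y)) Filter.atTop ≤
        ENNReal.ofReal K * (μ X * μ Y)) :
    ∀ X Y : Set (ℕ → Fin M), MeasurableSet X → MeasurableSet Y →
      Filter.Tendsto (fun n : ℕ => μ (X ∩ shift^[n] ⁻¹' Y)) Filter.atTop (nhds (μ X * μ Y)) := by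
  exact ow_main hinv herg K hK hls
end

section
/- Let A_1 = [[0,2],[1,0]] and A_2 = [[0,1],[2,0]] (as 2×2 real matrices) and let A = (A_1,A_2). Then for every s > 0 there exist constants C > 0 and P ∈ ℝ and a σ-invariant Borel probability measure μ on Σ_2 which satisfies the Gibbs inequality for (A,s) with constants C and P, but which is not ergodic with respect to σ² (and in particular is not mixing with respect to σ). -/
open MeasureTheory Filter Topology

namespace GibbsAux

/-- The multiplicative weight picked up by symbol `x` at time `c`. -/
noncomputable def h (c : ℕ) (x : Fin 2) : ℝ := if Even (c + (x : ℕ)) then 1 else 2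

lemma h_pos (c : ℕ) (x : Fin 2) : 0 < h c x := by
  unfold h; split_ifs <;> norm_num

lemma h_add_two (c : ℕ) (x : Fin 2) : h (c + 2) x = h c x := by
  have : Even (c + 2 + (x : ℕ)) ↔ Even (c + (x : ℕ)) := by
    simp [Nat.even_add, parity_simps]
  simp only [h, this]

/-- The weight of a word started at time `c`. -/
noncomputable def g : ℕ → List (Fin 2) → ℝ
  | _, [] => 1
  | c, x :: w => h c x * g (c + 1) w

lemma g_pos (c : ℕ) (w : List (Fin 2)) : 0 < g c w := by
  induction w generalizing c with
  | nil => simp [g]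
  | cons x w ih => exact mul_pos (h_pos _ _) (ih _)

lemma g_add_two (c : ℕ) (w : List (Fin 2)) : g (c + 2) w = g c w := by
  induction w generalizing c with
  | nil => simp [g]
  | cons x w ih =>
    simp only [g, h_add_two]
    rw [show c + 2 + 1 = (c + 1) + 2 by ring, ih]

/-- The pair of matrices. -/
noncomputable abbrev AA : Fin 2 → Matrix (Fin 2) (Fin 2) ℝ :=
  ![!![(0 : ℝ), 2; 1, 0], !![(0 : ℝ), 1; 2, 0]]

lemma conj_listProd (w : List (Fin 2)) :
    (listProd AA w).conjTranspose * listProd AA w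
      = Matrix.diagonal ![g 0 w ^ 2, g 1 w ^ 2] := by
  induction w with
  | nil =>
    ext i j
    fin_cases i <;> fin_cases j <;> simp [listProd, g]
  | cons x w ih =>
    have e : listProd AA (x :: w) = listProd AA w * AA x := by
      simp [listProd]
    rw [e, Matrix.conjTranspose_mul, Matrix.mul_assoc, ← Matrix.mul_assoc _ _ (AA x), ih]
    have h2 := g_add_two 0 w
    simp only [zero_add] at h2
    ext i j
    fin_cases x <;> fin_cases i <;> fin_cases j <;>
      simp [Matrix.mul_apply, Fin.sum_univ_two, g, h, h2, Matrix.diagonal, Matrix.conjTranspose] <;>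
      ring

open scoped Matrix.Norms.L2Operator in
lemma opNorm_listProd (w : List (Fin 2)) :
    opNorm (listProd AA w) = max (g 0 w) (g 1 w) := by
  have h1 := Matrix.l2_opNorm_conjTranspose_mul_self (listProd AA w)
  rw [conj_listProd, Matrix.l2_opNorm_diagonal] at h1
  have h0 := g_pos 0 w
  have h0' := g_pos 1 w
  have h3 : ‖(![g 0 w ^ 2, g 1 w ^ 2] : Fin 2 → ℝ)‖ = (max (g 0 w) (g 1 w)) ^ 2 := by
    apply le_antisymm
    · rw [pi_norm_le_iff_of_nonneg (by positivity)]
      intro i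
      fin_cases i
      · simp only [Fin.zero_eta, Matrix.cons_val_zero, Real.norm_eq_abs, abs_pow, abs_of_pos h0]
        gcongr; exact le_max_left _ _
      · simp only [Fin.mk_one, Matrix.cons_val_one, Matrix.cons_val_fin_one, Real.norm_eq_abs,
          abs_pow, abs_of_pos h0']
        gcongr; exact le_max_right _ _
    · rcases max_choice (g 0 w) (g 1 w) with hm | hm <;> rw [hm]
      · have := norm_le_pi_norm (![g 0 w ^ 2, g 1 w ^ 2] : Fin 2 → ℝ) 0
        simpa [abs_of_pos h0] using this
      · have := norm_le_pi_norm (![g 0 w ^ 2, g 1 w ^ 2] : Fin 2 → ℝ) 1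
        simpa [abs_of_pos h0'] using this
  rw [h3, ← sq] at h1
  have h4 : opNorm (listProd AA w) = ‖listProd AA w‖ := rfl
  rw [h4]
  exact ((sq_eq_sq₀ (by positivity) (by positivity)).1 h1).symm

/-- Probability weight. -/
noncomputable def q (s : ℝ) (c : ℕ) (x : Fin 2) : ℝ := h c x ^ s / (1 + 2 ^ s)

lemma q_nonneg (s : ℝ) (c : ℕ) (x : Fin 2) : 0 ≤ q s c x := by
  have := h_pos c x
  unfold q; positivity

lemma q_sum (s : ℝ) (c : ℕ) : q s c 0 + q s c 1 = 1 := by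
  have : (0:ℝ) < 2 ^ s := by positivity
  unfold q h
  rw [← add_div, div_eq_one_iff_eq (by positivity)]
  by_cases hc : Even c
  · simp [hc, parity_simps]
  · simp [hc, parity_simps]; ring

/-- The measure on symbols at time `c`. -/
noncomputable def β (s : ℝ) (c : ℕ) : Measure (Fin 2) :=
  ENNReal.ofReal (q s c 0) • Measure.dirac 0 + ENNReal.ofReal (q s c 1) • Measure.dirac 1

instance (s : ℝ) (c : ℕ) : IsProbabilityMeasure (β s c) := by
  constructor
  simp [β, ← ENNReal.ofReal_add (q_nonneg _ _ _) (q_nonneg _ _ _), q_sum]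

lemma β_singleton (s : ℝ) (c : ℕ) (x : Fin 2) : β s c {x} = ENNReal.ofReal (q s c x) := by
  fin_cases x <;> simp [β]

lemma β_add_two (s : ℝ) (c : ℕ) : β s (c + 2) = β s c := by
  simp [β, q, h_add_two]

/-- The product measure started at time `c`. -/
noncomputable def ν (s : ℝ) (c : ℕ) : Measure (ℕ → Fin 2) :=
  Measure.infinitePi (fun n => β s (c + n))

instance (s : ℝ) (c : ℕ) : IsProbabilityMeasure (ν s c) := by
  unfold ν; infer_instance

lemma ν_add_two (s : ℝ) (c : ℕ) : ν s (c + 2) = ν s c := by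
  unfold ν
  congr 1
  funext n
  rw [show c + 2 + n = (c + n) + 2 by ring, β_add_two]

lemma measurable_shift : Measurable (shift (M := 2)) := by
  unfold shift; fun_prop

lemma map_shift (s : ℝ) (c : ℕ) : (ν s c).map shift = ν s (c + 1) := by
  apply Measure.eq_infinitePi
  intro S t ht
  rw [Measure.map_apply measurable_shift (MeasurableSet.pi S.countable_toSet fun i _ => ht i)]
  have : shift ⁻¹' (Set.pi (S : Set ℕ) t)
      = Set.pi ((S.map (addRightEmbedding 1) : Finset ℕ) : Set ℕ) (fun i => t (i - 1)) := by
    ext y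
    simp [Set.mem_pi, shift]
  rw [this, ν, Measure.infinitePi_pi _ (fun i _ => ht _), Finset.prod_map]
  refine Finset.prod_congr rfl fun i _ => ?_
  have e : c + (i + 1) = c + 1 + i := by ring
  change β s (c + (i + 1)) (t (i + 1 - 1)) = _
  rw [e, Nat.add_sub_cancel]

lemma ν_cyl (s : ℝ) (c : ℕ) (w : List (Fin 2)) :
    ν s c (cyl w) = ∏ i ∈ Finset.range w.length, ENNReal.ofReal (q s (c + i) (w.getD i 0)) := by
  have : cyl w = Set.pi (Finset.range w.length : Set ℕ) (fun i => {w.getD i 0}) := by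
    ext y
    simp only [cyl, Set.mem_ofPred_eq, Set.mem_pi, Finset.coe_range, Set.mem_Iio,
      Set.mem_singleton_iff]
    constructor
    · intro hy i hi
      rw [List.getD_eq_getElem _ _ hi]
      exact hy ⟨i, hi⟩
    · rintro hy ⟨i, hi⟩
      have := hy i hi
      rw [List.getD_eq_getElem _ _ hi] at this
      exact this
  rw [this, ν, Measure.infinitePi_pi _ (fun i _ => measurableSet_singleton _)]
  simp only [β_singleton]

lemma ν_cyl_real (s : ℝ) (c : ℕ) (w : List (Fin 2)) :
    (ν s c (cyl w)).toReal = g c w ^ s / (1 + 2 ^ s) ^ w.length := by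
  rw [ν_cyl, ENNReal.toReal_prod]
  induction w generalizing c with
  | nil => simp [g]
  | cons x w ih =>
    rw [List.length_cons, Finset.prod_range_succ']
    have e : ∀ k ∈ Finset.range w.length,
        (ENNReal.ofReal (q s (c + (k + 1)) ((x :: w).getD (k + 1) 0))).toReal
          = (ENNReal.ofReal (q s (c + 1 + k) (w.getD k 0))).toReal := fun k _ => by
      rw [List.getD_cons_succ, show c + (k + 1) = c + 1 + k by ring]
    rw [Finset.prod_congr rfl e, List.getD_cons_zero, ih, add_zero, ENNReal.toReal_ofReal (q_nonneg _ _ _), q, g,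
      Real.mul_rpow (h_pos _ _).le (g_pos _ _).le, pow_succ]
    field_simp

/-- The Gibbs measure. -/
noncomputable def μ (s : ℝ) : Measure (ℕ → Fin 2) :=
  (2⁻¹ : ENNReal) • (ν s 0 + ν s 1)

lemma μ_cyl_real (s : ℝ) (w : List (Fin 2)) :
    (μ s (cyl w)).toReal = (g 0 w ^ s + g 1 w ^ s) / 2 / (1 + 2 ^ s) ^ w.length := by
  simp only [μ, Measure.smul_apply, Measure.add_apply, smul_eq_mul, ENNReal.toReal_mul]
  rw [ENNReal.toReal_add (measure_ne_top _ _) (measure_ne_top _ _), ν_cyl_real, ν_cyl_real]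
  simp
  ring

instance (s : ℝ) : IsProbabilityMeasure (μ s) := by
  constructor
  simp only [μ, Measure.smul_apply, Measure.add_apply, smul_eq_mul, measure_univ]
  rw [one_add_one_eq_two]
  exact ENNReal.inv_mul_cancel (by simp) (by simp)

lemma μ_inv (s : ℝ) : MeasurePreserving (shift (M := 2)) (μ s) (μ s) := by
  refine ⟨measurable_shift, ?_⟩
  rw [μ, Measure.map_smul, Measure.map_add _ _ measurable_shift, map_shift, map_shift]
  have := ν_add_two s 0
  simp only [zero_add, Nat.reduceAdd] at this ⊢
  rw [this, add_comm]

lemma ν_inv (s : ℝ) (c : ℕ) : MeasurePreserving (shift (M := 2))^[2] (ν s c) (ν s c) := by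
  refine ⟨measurable_shift.iterate 2, ?_⟩
  rw [Function.iterate_succ, Function.iterate_one, ← Measure.map_map measurable_shift
    measurable_shift, map_shift, map_shift, ν_add_two]

lemma not_ergodic (s : ℝ) (hs : 0 < s) : ¬ Ergodic ((shift (M := 2))^[2]) (μ s) := by
  intro H
  have hac : ν s 0 ≪ μ s := by
    refine Measure.AbsolutelyContinuous.mk fun t _ ht => ?_
    simp only [μ, Measure.smul_apply, Measure.add_apply, smul_eq_mul, mul_eq_zero] at ht
    rcases ht with ht | ht
    · simp at ht
    · exact (add_eq_zero.1 ht).1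
  have heq := H.eq_of_absolutelyContinuous (ν_inv s 0) hac
  have h1 := ν_cyl_real s 0 [0]
  rw [heq, μ_cyl_real] at h1
  have h2 : (1:ℝ) < 2 ^ s := Real.one_lt_rpow (by norm_num) hs
  simp [g, h] at h1
  have h3 : (1 + (2:ℝ) ^ s) ≠ 0 := by positivity
  field_simp at h1
  linarith

lemma gibbs (s : ℝ) (hs : 0 < s) : IsGibbs AA s 2 (Real.log (1 + 2 ^ s)) (μ s) := by
  intro w _
  have h2 : (0:ℝ) < 1 + 2 ^ s := by positivity
  have hexp : Real.exp (-(w.length : ℝ) * Real.log (1 + 2 ^ s)) = ((1 + 2 ^ s) ^ w.length)⁻¹ := by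
    rw [neg_mul, Real.exp_neg, Real.exp_nat_mul, Real.exp_log h2]
  have h0 := g_pos 0 w
  have h0' := g_pos 1 w
  have hm : (max (g 0 w) (g 1 w)) ^ s = max (g 0 w ^ s) (g 1 w ^ s) := by
    rcases le_total (g 0 w) (g 1 w) with hh | hh
    · rw [max_eq_right hh, max_eq_right (Real.rpow_le_rpow h0.le hh hs.le)]
    · rw [max_eq_left hh, max_eq_left (Real.rpow_le_rpow h0'.le hh hs.le)]
  rw [hexp, opNorm_listProd, hm, μ_cyl_real]
  have p0 : 0 < g 0 w ^ s := by positivity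
  have p1 : 0 < g 1 w ^ s := by positivity
  have hD : 0 < ((1 + (2:ℝ) ^ s) ^ w.length)⁻¹ := by positivity
  have l1 := le_max_left (g 0 w ^ s) (g 1 w ^ s)
  have l2 := le_max_right (g 0 w ^ s) (g 1 w ^ s)
  have l3 := max_le_add_of_nonneg p0.le p1.le
  rw [div_eq_mul_inv _ ((1 + (2:ℝ) ^ s) ^ w.length)]
  generalize ((1 + (2:ℝ) ^ s) ^ w.length)⁻¹ = D at *
  constructor
  · nlinarith
  · nlinarith

end GibbsAux

/-- for the explicit pair `A₁ = [[0,2],[1,0]]`, `A₂ = [[0,1],[2,0]]` there is a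
shift-invariant Gibbs measure for `(A,s)` which is not ergodic for `σ²`. -/
theorem stmt_6 :
    ∀ s : ℝ, 0 < s →
      ∃ (C P : ℝ) (μ : Measure (ℕ → Fin 2)), 0 < C ∧ IsProbabilityMeasure μ ∧
        MeasurePreserving (shift (M := 2)) μ μ ∧
        IsGibbs (![!![(0 : ℝ), 2; 1, 0], !![(0 : ℝ), 1; 2, 0]]) s C P μ ∧
        ¬ Ergodic ((shift (M := 2))^[2]) μ := by
  intro s hs
  exact ⟨2, Real.log (1 + 2 ^ s), GibbsAux.μ s, by norm_num, inferInstance, GibbsAux.μ_inv s,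
    GibbsAux.gibbs s hs, GibbsAux.not_ergodic s hs⟩
end

section
/- Let M ≥ 2, let A = (A_1,…,A_M) be a tuple of d×d real matrices and let ℓ ≥ 1 be an integer. If ϱ_∞(A) = ϱ_{2ℓ}(A), then there exist n ≥ 1 and x_1,…,x_n ∈ {1,…,M} such that ρ(A_{x_n}⋯A_{x_1})^{1/n} = ϱ_∞(A). -/
open MeasureTheory Filter Topology

/-- The `p`-radius `ϱ_p(A) = inf_{n ≥ 1} ( Σ_{|x| = n} ‖A_{x_n} ⋯ A_{x_1}‖^p )^{1/(np)}`. -/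
noncomputable def pRadius {M d : ℕ} (A : Fin M → Matrix (Fin d) (Fin d) ℝ) (p : ℝ) : ℝ :=
  ⨅ n : ℕ, (∑ x : Fin (n + 1) → Fin M, opNorm (wordProd A x) ^ p) ^
    ((1 : ℝ) / ((n + 1) * p))

/-- The joint spectral radius `ϱ_∞(A) = inf_{n ≥ 1} max_{|x| = n} ‖A_{x_n} ⋯ A_{x_1}‖^{1/n}`. -/
noncomputable def jsr {M d : ℕ} (A : Fin M → Matrix (Fin d) (Fin d) ℝ) : ℝ :=
  ⨅ n : ℕ, (⨆ x : Fin (n + 1) → Fin M, opNorm (wordProd A x)) ^ ((1 : ℝ) / (n + 1))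


theorem comb_aux {α : Type*} (u : List α) (q n : ℕ) (hu : (u.drop q).take n = u.take n) :
    ∀ k, k * q ≤ n + q → k * q ≤ u.length → (List.replicate k (u.take q)).flatten = u.take (k * q) := by
  intro k
  induction k with
  | zero => intro _ _; simp
  | succ k ih =>
    intro h h'
    have e : (k+1) * q = q + k * q := by ring
    have hk : k * q ≤ n := by rw [e] at h; omega
    rw [List.replicate_succ, List.flatten_cons, ih (by omega) (by rw [e] at h'; omega), e, List.take_add]
    congr 1
    have := congrArg (List.take (k * q)) hu
    rw [List.take_take, List.take_take, min_eq_left hk] at this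
    exact this.symm

theorem comb {α : Type*} [Fintype α] [DecidableEq α] (L : List α → Prop)
    (hf : ∀ a b c, L (a ++ (b ++ c)) → L b)
    (hne : ∀ n, ∃ w : List α, w.length = n ∧ L w) (N : ℕ)
    (hN : ∀ n (T : Finset (List α)), (∀ w ∈ T, w.length = n ∧ L w) → T.card ≤ N) :
    ∃ w : List α, w ≠ [] ∧ ∀ k, L ((List.replicate k w).flatten) := by
  have hk : ∀ k, ∃ w : List α, w ≠ [] ∧ w.length ≤ N ∧ L ((List.replicate k w).flatten) := by
    intro k
    obtain ⟨u, hul, hu⟩ := hne (N + k * N)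
    have hfac : ∀ i m, L ((u.drop i).take m) := by
      intro i m
      apply hf (u.take i) _ ((u.drop i).drop m)
      rwa [List.take_append_drop, List.take_append_drop]
    set φ : ℕ → List α := fun i => (u.drop i).take (k * N) with hφ
    have hlen : ∀ i ≤ N, (φ i).length = k * N := by
      intro i hi
      simp [hφ, hul]; omega
    have h1 := hN (k * N) ((Finset.range (N+1)).image φ) (by
      intro w hw
      obtain ⟨i, hi, rfl⟩ := Finset.mem_image.1 hw
      exact ⟨hlen i (by simpa [Nat.lt_succ_iff] using hi), hfac _ _⟩)
    have h2 : ∃ i j, i < j ∧ j ≤ N ∧ φ i = φ j := by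
      have : ((Finset.range (N+1)).image φ).card < (Finset.range (N+1)).card := by simp; omega
      obtain ⟨i, hi, j, hj, hij, he⟩ := Finset.exists_ne_map_eq_of_card_lt_of_maps_to this
        (fun x hx => Finset.mem_coe.2 (Finset.mem_image_of_mem φ hx))
      simp at hi hj
      rcases lt_or_gt_of_ne hij with h | h
      · exact ⟨i, j, h, by omega, he⟩
      · exact ⟨j, i, h, by omega, he.symm⟩
    obtain ⟨i, j, hij, hj, he⟩ := h2
    have hkq : k * (j - i) ≤ k * N := Nat.mul_le_mul_left _ (by omega)
    have hlu : (u.drop i).length = N + k * N - i := by simp [hul]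
    refine ⟨(u.drop i).take (j - i), ?_, ?_, ?_⟩
    · intro h
      have := congrArg List.length h
      rw [List.length_take, hlu] at this
      simp at this
      omega
    · rw [List.length_take]; omega
    · rw [comb_aux (u.drop i) (j - i) (k * N) ?_ k (by omega) (by omega)]
      · exact hfac _ _
      · rw [List.drop_drop, show i + (j - i) = j by omega]
        exact he.symm
  by_contra hcon
  push Not at hcon
  choose! kf hkf using hcon
  have hfin : (kf '' {l : List α | l.length ≤ N}).Finite := (List.finite_length_le α N).image _
  obtain ⟨K, hK⟩ := hfin.bddAbove
  obtain ⟨w, hw, hwN, hwL⟩ := hk K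
  have hle : kf w ≤ K := hK ⟨w, hwN, rfl⟩
  apply hkf w hw
  have : List.replicate K w = List.replicate (kf w) w ++ List.replicate (K - kf w) w := by
    rw [← List.replicate_add]; congr 1; omega
  rw [this, List.flatten_append] at hwL
  exact hf [] _ _ (by simpa using hwL)

structure CH {E : Type*} [AddCommGroup E] [Module ℝ E] (s : ℕ) (f : E → ℝ) : Prop where
  nonneg : ∀ v, 0 ≤ f v
  conv : ConvexOn ℝ Set.univ f
  homog : ∀ (c : ℝ) v, f (c • v) = |c| ^ s * f v

namespace CH
variable {E : Type*} [AddCommGroup E] [Module ℝ E] {s : ℕ}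

theorem quasi {f : E → ℝ} (hf : CH s f) (u v : E) : f (u + v) ≤ 2 ^ s * (f u + f v) := by
  have h := hf.conv.2 (Set.mem_univ u) (Set.mem_univ v) (show (0:ℝ) ≤ 1/2 by norm_num)
    (show (0:ℝ) ≤ 1/2 by norm_num) (by norm_num)
  rw [← smul_add, hf.homog] at h
  have h2 : (|(1/2 : ℝ)|) ^ s * 2 ^ s = 1 := by
    rw [← mul_pow, abs_of_pos (by norm_num)]; norm_num
  have hp : (0:ℝ) < 2 ^ s := by positivity
  have h3 := mul_le_mul_of_nonneg_left h hp.le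
  have h4 : 2 ^ s * (|(1/2 : ℝ)| ^ s * f (u + v)) = f (u + v) := by
    rw [← mul_assoc, mul_comm (2^s : ℝ), h2, one_mul]
  rw [h4] at h3
  refine h3.trans (mul_le_mul_of_nonneg_left ?_ hp.le)
  have := hf.nonneg u
  have := hf.nonneg v
  simp only [smul_eq_mul]
  linarith

theorem comp {F : Type*} [AddCommGroup F] [Module ℝ F] {f : E → ℝ} (hf : CH s f) (L : F →ₗ[ℝ] E) :
    CH s (fun v => f (L v)) where
  nonneg v := hf.nonneg _
  conv := by simpa [Function.comp_def] using hf.conv.comp_linearMap L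
  homog c v := by simp [hf.homog]

theorem lim {ι : Type*} {l : Filter ι} [l.NeBot] {g : ι → E → ℝ} {f : E → ℝ}
    (hg : ∀ i, CH s (g i)) (h : ∀ v, Tendsto (fun i => g i v) l (𝓝 (f v))) : CH s f where
  nonneg v := ge_of_tendsto' (h v) (fun i => (hg i).nonneg v)
  conv := by
    refine ⟨convex_univ, ?_⟩
    intro x hx y hy a b ha hb hab
    exact le_of_tendsto_of_tendsto' (h _) (((h x).const_smul a).add ((h y).const_smul b))
      (fun i => (hg i).conv.2 hx hy ha hb hab)
  homog c v := by
    refine tendsto_nhds_unique (h _) ?_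
    simp_rw [(hg _).homog]
    exact (h v).const_mul _

theorem zero : CH s (fun _ : E => (0:ℝ)) where
  nonneg _ := le_rfl
  conv := convexOn_const _ convex_univ
  homog _ _ := by simp

theorem add {f g : E → ℝ} (hf : CH s f) (hg : CH s g) : CH s (fun v => f v + g v) where
  nonneg v := add_nonneg (hf.nonneg v) (hg.nonneg v)
  conv := hf.conv.add hg.conv
  homog c v := by rw [hf.homog, hg.homog]; ring

theorem sum {ι : Type*} (T : Finset ι) {g : ι → E → ℝ} (hg : ∀ i, CH s (g i)) :
    CH s (fun v => ∑ i ∈ T, g i v) := by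
  classical
  induction T using Finset.induction_on with
  | empty => simpa using zero
  | insert a T ha ih => simp_rw [Finset.sum_insert ha]; exact (hg a).add ih

theorem smul {f : E → ℝ} (hf : CH s f) {a : ℝ} (ha : 0 ≤ a) : CH s (fun v => a * f v) where
  nonneg v := mul_nonneg ha (hf.nonneg v)
  conv := hf.conv.smul ha
  homog c v := by rw [hf.homog]; ring

theorem norm {E : Type*} [NormedAddCommGroup E] [NormedSpace ℝ E] : CH s (fun v : E => ‖v‖ ^ s) where
  nonneg v := by positivity
  conv := (convexOn_norm convex_univ).pow (fun _ _ => norm_nonneg _) s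
  homog c v := by rw [norm_smul, mul_pow, Real.norm_eq_abs]

/-- control by the values on the basis -/
theorem jen {d : ℕ} {f : EuclideanSpace ℝ (Fin d) → ℝ} (hf : CH s f) (v : EuclideanSpace ℝ (Fin d)) (hs : s ≠ 0) :
    f v ≤ (d:ℝ) ^ s * ‖v‖ ^ s * ∑ j, f (EuclideanSpace.single j 1) := by
  rcases Nat.eq_zero_or_pos d with rfl | hd
  · have : v = (0:ℝ) • v := Subsingleton.elim _ _
    rw [this, hf.homog]; simp [hs]
  have hd' : (0:ℝ) < d := by exact_mod_cast hd
  have hv : v = ∑ j : Fin d, (1 / (d:ℝ)) • ((d * v j) • EuclideanSpace.single j (1:ℝ)) := by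
    ext i
    simp [Finset.sum_apply, Pi.single_apply]
    field_simp
  have := hf.conv.map_sum_le (t := Finset.univ) (w := fun _ : Fin d => 1 / (d:ℝ))
    (p := fun j => (d * v j) • EuclideanSpace.single j (1:ℝ)) (fun _ _ => by positivity)
    (by simp [hd'.ne']) (fun _ _ => Set.mem_univ _)
  rw [← hv] at this
  refine this.trans ?_
  rw [Finset.mul_sum]
  refine Finset.sum_le_sum fun j _ => ?_
  rw [hf.homog, abs_mul, abs_of_pos hd', mul_pow, smul_eq_mul]
  have h0 := hf.nonneg (EuclideanSpace.single j 1)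
  have h1 : |v j| ^ s ≤ ‖v‖ ^ s := by
    gcongr
    simpa using PiLp.norm_apply_le v j
  have h2 : 1 / (d:ℝ) ≤ 1 := by
    rw [div_le_one hd']; exact_mod_cast hd
  calc 1 / (d:ℝ) * (d ^ s * |v j| ^ s * f (EuclideanSpace.single j 1))
      ≤ 1 * (d ^ s * |v j| ^ s * f (EuclideanSpace.single j 1)) := by gcongr
    _ ≤ _ := by rw [one_mul]; gcongr
end CH

section words
variable {M d : ℕ}

noncomputable def wp (B : Fin M → (EuclideanSpace ℝ (Fin d) →L[ℝ] EuclideanSpace ℝ (Fin d))) :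
    List (Fin M) → (EuclideanSpace ℝ (Fin d) →L[ℝ] EuclideanSpace ℝ (Fin d))
  | [] => 1
  | i :: w => wp B w * B i

variable (B : Fin M → (EuclideanSpace ℝ (Fin d) →L[ℝ] EuclideanSpace ℝ (Fin d)))

theorem wp_append (a b : List (Fin M)) : wp B (a ++ b) = wp B b * wp B a := by
  induction a with
  | nil => simp [wp]
  | cons i a ih => simp [wp, ih, mul_assoc]

theorem wp_replicate (w : List (Fin M)) (k : ℕ) :
    wp B (List.replicate k w).flatten = wp B w ^ k := by
  induction k with
  | zero => simp [wp]
  | succ k ih => rw [List.replicate_succ, List.flatten_cons, wp_append, ih, pow_succ]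

noncomputable def wsum (n : ℕ) (F : List (Fin M) → ℝ) : ℝ := ∑ x : Fin n → Fin M, F (List.ofFn x)

theorem wsum_zero (F : List (Fin M) → ℝ) : wsum 0 F = F [] := by simp [wsum]

theorem wsum_succ (n : ℕ) (F : List (Fin M) → ℝ) :
    wsum (n+1) F = ∑ i, wsum n (fun w => F (i :: w)) := by
  unfold wsum
  rw [← (Fin.consEquiv (fun _ : Fin (n+1) => Fin M)).sum_comp, Fintype.sum_prod_type]
  simp [Fin.consEquiv, List.ofFn_succ]

theorem wsum_add (n m : ℕ) (F : List (Fin M) → ℝ) :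
    wsum (n+m) F = wsum n (fun a => wsum m (fun b => F (a ++ b))) := by
  induction n generalizing F with
  | zero => simp [wsum_zero]
  | succ n ih =>
    rw [show n + 1 + m = (n + m) + 1 by ring, wsum_succ, wsum_succ]
    simp_rw [ih]
    rfl

theorem wsum_mono (n : ℕ) {F G : List (Fin M) → ℝ} (h : ∀ w, w.length = n → F w ≤ G w) :
    wsum n F ≤ wsum n G :=
  Finset.sum_le_sum fun x _ => h _ (by simp)

theorem wsum_mul (n : ℕ) (c : ℝ) (F : List (Fin M) → ℝ) :
    wsum n (fun w => c * F w) = c * wsum n F := by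
  simp [wsum, Finset.mul_sum]

theorem le_wsum {F : List (Fin M) → ℝ} (hF : ∀ w, 0 ≤ F w) (w : List (Fin M)) :
    F w ≤ wsum w.length F := by
  have := Finset.single_le_sum (f := fun x : Fin w.length → Fin M => F (List.ofFn x))
    (fun x _ => hF _) (Finset.mem_univ w.get)
  simpa [wsum] using this

theorem sum_le_wsum {F : List (Fin M) → ℝ} (hF : ∀ w, 0 ≤ F w) (n : ℕ) (T : Finset (List (Fin M)))
    (hT : ∀ w ∈ T, w.length = n) : ∑ w ∈ T, F w ≤ wsum n F := by
  classical
  have h1 : wsum n F = ∑ w ∈ (Finset.univ : Finset (Fin n → Fin M)).image List.ofFn, F w := by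
    rw [Finset.sum_image]
    · rfl
    · intro x _ y _ h; exact List.ofFn_injective h
  rw [h1]
  refine Finset.sum_le_sum_of_subset_of_nonneg ?_ (fun w _ _ => hF w)
  intro w hw
  have := hT w hw
  subst this
  exact Finset.mem_image.2 ⟨w.get, Finset.mem_univ _, by simp⟩

theorem wsum_inv {f : EuclideanSpace ℝ (Fin d) → ℝ} (hB : ∀ v, f v = ∑ i, f (B i v)) (n : ℕ) (v) :
    wsum n (fun w => f (wp B w v)) = f v := by
  induction n generalizing v with
  | zero => simp [wsum_zero, wp]
  | succ n ih =>
    rw [wsum_succ, hB v]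
    refine Finset.sum_congr rfl fun i _ => ?_
    rw [← ih (B i v)]
    rfl

noncomputable def SS (p n : ℕ) : ℝ := wsum n (fun w => ‖wp B w‖ ^ p)

theorem SS_nonneg (p n : ℕ) : 0 ≤ SS B p n := Finset.sum_nonneg fun _ _ => by positivity

theorem SS_add (p n m : ℕ) : SS B p (n + m) ≤ SS B p n * SS B p m := by
  unfold SS
  rw [wsum_add]
  calc _ ≤ wsum n (fun a => wsum m (fun b => ‖wp B a‖ ^ p * ‖wp B b‖ ^ p)) := by
        refine wsum_mono n fun a _ => wsum_mono m fun b _ => ?_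
        rw [wp_append, ← mul_pow, mul_comm ‖wp B a‖]
        gcongr
        exact norm_mul_le _ _
    _ = _ := by
        simp_rw [wsum_mul, mul_comm _ (wsum m _), wsum_mul]

theorem SS_bound (p n0 : ℕ) (hn0 : 0 < n0) (θ : ℝ) (hθ : 1 < θ) (h : SS B p n0 ≤ θ ^ n0) :
    ∃ C, 0 ≤ C ∧ ∀ n, SS B p n ≤ C * θ ^ n := by
  have hS := SS_nonneg B p
  refine ⟨∑ r ∈ Finset.range n0, SS B p r, Finset.sum_nonneg fun r _ => hS r, ?_⟩
  have hC : 0 ≤ ∑ r ∈ Finset.range n0, SS B p r := Finset.sum_nonneg fun r _ => hS r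
  intro n
  induction n using Nat.strong_induction_on with
  | _ n ih =>
    by_cases hn : n < n0
    · have h1 := Finset.single_le_sum (f := SS B p) (fun r _ => hS r) (Finset.mem_range.2 hn)
      exact h1.trans (le_mul_of_one_le_right hC (one_le_pow₀ hθ.le))
    · obtain ⟨m, rfl⟩ := Nat.exists_eq_add_of_le (not_lt.1 hn)
      calc _ ≤ SS B p n0 * SS B p m := SS_add ..
        _ ≤ θ ^ n0 * ((∑ r ∈ Finset.range n0, SS B p r) * θ ^ m) := by
          gcongr
          · exact hS m
          · exact ih m (by omega)
        _ = _ := by ring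

theorem SS_two (p n : ℕ) : SS B (2 * p) n ≤ SS B p n ^ 2 := by
  unfold SS wsum
  simp_rw [mul_comm 2 p, pow_mul]
  exact Finset.sum_sq_le_sq_sum_of_nonneg (fun _ _ => by positivity)

/-- comparison on the quotient by the kernel -/
theorem sem {s : ℕ} (hs : s ≠ 0) {f : EuclideanSpace ℝ (Fin d) → ℝ} (hf : CH s f) :
    ∃ C, 0 ≤ C ∧ ∀ L : EuclideanSpace ℝ (Fin d) →L[ℝ] EuclideanSpace ℝ (Fin d),
      (∀ u, f u = 0 → f (L u) = 0) →
      ∀ v, f (L v) ≤ C * f v * ∑ j, f (L (EuclideanSpace.single j 1)) := by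
  let K : Submodule ℝ (EuclideanSpace ℝ (Fin d)) :=
    { carrier := {v | f v = 0}
      zero_mem' := by
        have := hf.homog 0 0
        simpa [hs] using this
      add_mem' := by
        intro a b ha hb
        have := hf.quasi a b
        simp only [Set.mem_ofPred_eq] at ha hb ⊢
        rw [ha, hb] at this
        exact le_antisymm (by simpa using this) (hf.nonneg _)
      smul_mem' := by
        intro c x hx
        simp only [Set.mem_ofPred_eq] at hx ⊢
        rw [hf.homog, hx, mul_zero] }
  have hKm : ∀ v, v ∈ K ↔ f v = 0 := fun v => Iff.rfl
  have hcont : Continuous f := by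
    rw [← continuousOn_univ]
    exact hf.conv.continuousOn isOpen_univ
  have hcomp : IsCompact (Metric.sphere (0 : EuclideanSpace ℝ (Fin d)) 1 ∩ (Kᗮ : Set _)) :=
    (isCompact_sphere _ _).inter_right (Submodule.isClosed_orthogonal K)
  have hδ : ∃ δ > 0, ∀ w ∈ Metric.sphere (0 : EuclideanSpace ℝ (Fin d)) 1 ∩ (Kᗮ : Set _), δ ≤ f w := by
    rcases (Metric.sphere (0 : EuclideanSpace ℝ (Fin d)) 1 ∩ (Kᗮ : Set _)).eq_empty_or_nonempty with h | h
    · exact ⟨1, one_pos, by rw [h]; simp⟩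
    · obtain ⟨x, hx, hmin⟩ := hcomp.exists_isMinOn h hcont.continuousOn
      refine ⟨f x, lt_of_le_of_ne (hf.nonneg x) ?_, fun w hw => hmin hw⟩
      intro h0
      have hxK : x ∈ K := (hKm x).2 h0.symm
      have : inner ℝ x x = 0 := hx.2 x hxK
      rw [inner_self_eq_zero] at this
      have h1 := hx.1
      rw [this] at h1
      simp at h1
  obtain ⟨δ, hδ0, hδ⟩ := hδ
  have hlow : ∀ w ∈ Kᗮ, δ * ‖w‖ ^ s ≤ f w := by
    intro w hw
    by_cases h0 : w = 0
    · subst h0; simp [hs]; exact hf.nonneg _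
    · have hn : 0 < ‖w‖ := norm_pos_iff.2 h0
      have h1 := hδ (‖w‖⁻¹ • w) ⟨by simp [norm_smul, hn.ne'], Kᗮ.smul_mem _ hw⟩
      rw [hf.homog, abs_of_pos (inv_pos.2 hn), inv_pow] at h1
      rw [← le_div_iff₀ (by positivity)]
      rwa [inv_mul_eq_div] at h1
  refine ⟨2 ^ s * d ^ s * δ⁻¹ * 2 ^ s, by positivity, ?_⟩
  intro L hL v
  set u := K.starProjection v with hu
  have huK : u ∈ K := Submodule.starProjection_apply_mem _ _
  set w := v - u with hw
  have hwK : w ∈ Kᗮ := Submodule.sub_starProjection_mem_orthogonal v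
  have e1 : f (L v) ≤ 2 ^ s * f (L w) := by
    have := hf.quasi (L u) (L w)
    rw [← map_add, hL u huK, zero_add] at this
    simpa [hw] using this
  have e2 : f w ≤ 2 ^ s * f v := by
    have := hf.quasi v (-u)
    have h0 : f (-u) = 0 := K.neg_mem huK
    rw [h0, add_zero, ← sub_eq_add_neg] at this
    exact this
  have hLf : CH s (fun v => f (L v)) := hf.comp L.toLinearMap
  have e3 : f (L w) ≤ (d:ℝ) ^ s * ‖w‖ ^ s * ∑ j, f (L (EuclideanSpace.single j 1)) := hLf.jen w hs
  have e4 : ‖w‖ ^ s ≤ δ⁻¹ * f w := by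
    rw [← div_eq_inv_mul, le_div_iff₀ hδ0, mul_comm]; exact hlow w hwK
  have hsum : 0 ≤ ∑ j, f (L (EuclideanSpace.single j 1)) := Finset.sum_nonneg fun j _ => hf.nonneg _
  calc f (L v) ≤ 2 ^ s * ((d:ℝ) ^ s * (δ⁻¹ * (2 ^ s * f v)) * ∑ j, f (L (EuclideanSpace.single j 1))) := by
        refine e1.trans ?_
        gcongr
        refine e3.trans ?_
        gcongr
        refine e4.trans ?_
        gcongr
    _ = _ := by ring

noncomputable def aa (s n : ℕ) (v : EuclideanSpace ℝ (Fin d)) : ℝ := wsum n (fun w => ‖wp B w v‖ ^ s)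

theorem aa_CH (s n : ℕ) : CH s (aa B s n) :=
  CH.sum Finset.univ (g := fun (x : Fin n → Fin M) v => ‖wp B (List.ofFn x) v‖ ^ s)
    (fun x => (CH.norm (s := s)).comp (wp B (List.ofFn x)).toLinearMap)

theorem aa_succ (s n : ℕ) (v) : aa B s (n+1) v = ∑ i, aa B s n (B i v) := by
  unfold aa
  rw [wsum_succ]
  rfl

theorem aa_le (s n : ℕ) (v) : aa B s n v ≤ ‖v‖ ^ s * SS B s n := by
  unfold aa SS
  rw [← wsum_mul]
  refine wsum_mono n fun w _ => ?_
  rw [← mul_pow, mul_comm]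
  gcongr
  exact (wp B w).le_opNorm v

theorem low_norm {s : ℕ} (hs : s ≠ 0) (L : EuclideanSpace ℝ (Fin d) →L[ℝ] EuclideanSpace ℝ (Fin d))
    (hL : 1 ≤ ‖L‖) : (1/2) ^ s / ((d:ℝ) ^ s + 1) ≤ ∑ j, ‖L (EuclideanSpace.single j 1)‖ ^ s := by
  obtain ⟨x, hx, hLx⟩ := L.exists_lt_apply_of_lt_opNorm (show (1/2 : ℝ) < ‖L‖ by linarith)
  have h1 := ((CH.norm (s := s)).comp L.toLinearMap).jen x hs
  have hsum : 0 ≤ ∑ j : Fin d, ‖L (EuclideanSpace.single j 1)‖ ^ s :=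
    Finset.sum_nonneg fun j _ => by positivity
  have h2 : ‖L x‖ ^ s ≤ (d:ℝ) ^ s * ‖x‖ ^ s * ∑ j, ‖L (EuclideanSpace.single j 1)‖ ^ s := h1
  rw [div_le_iff₀ (by positivity)]
  have h3 : ‖x‖ ^ s ≤ 1 := pow_le_one₀ (norm_nonneg _) hx.le
  have h4 : (1/2 : ℝ) ^ s ≤ ‖L x‖ ^ s := pow_le_pow_left₀ (by norm_num) hLx.le s
  generalize (∑ j : Fin d, ‖L (EuclideanSpace.single j 1)‖ ^ s) = S at h2 hsum ⊢
  have h5 : (d:ℝ) ^ s * ‖x‖ ^ s * S ≤ (d:ℝ) ^ s * 1 * S :=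
    mul_le_mul_of_nonneg_right (mul_le_mul_of_nonneg_left h3 (by positivity)) hsum
  linarith

theorem exists_f (p : ℕ) (hp : 0 < p)
    (H1 : ∀ θ : ℝ, 1 < θ → ∃ n0, 0 < n0 ∧ SS B p n0 ≤ θ ^ n0)
    (H2 : ∀ n, ∃ w : List (Fin M), w.length = n ∧ 1 ≤ ‖wp B w‖) :
    ∃ f : EuclideanSpace ℝ (Fin d) → ℝ, CH (2 * p) f ∧ (∀ v, f v = ∑ i, f (B i v)) ∧
      ∑ j, f (EuclideanSpace.single j 1) = 1 := by
  set s := 2 * p with hs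
  have hs0 : s ≠ 0 := by omega
  have hsummable : ∀ t : ℝ, 0 ≤ t → t < 1 → ∀ v, Summable (fun n => t ^ n * aa B s n v) := by
    intro t ht0 ht1 v
    have hq : 1 < 2 / (1 + t) := by rw [lt_div_iff₀ (by linarith)]; linarith
    set θ := Real.sqrt (2 / (1 + t)) with hθ
    have hθ1 : 1 < θ := by rw [hθ, Real.lt_sqrt (by norm_num)]; simpa using hq
    have hθ2 : θ ^ 2 = 2 / (1 + t) := Real.sq_sqrt (by positivity)
    obtain ⟨n0, hn0, hS⟩ := H1 θ hθ1
    obtain ⟨C, hC0, hC⟩ := SS_bound B p n0 hn0 θ hθ1 hS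
    have hlt : θ ^ 2 * t < 1 := by
      rw [hθ2, div_mul_eq_mul_div, div_lt_one (by linarith)]; linarith
    refine Summable.of_nonneg_of_le (fun n => mul_nonneg (pow_nonneg ht0 n) ((aa_CH B s n).nonneg v))
      (f := fun n => (‖v‖ ^ s * C ^ 2) * (θ ^ 2 * t) ^ n) ?_
      ((summable_geometric_of_lt_one (by positivity) hlt).mul_left _)
    intro n
    calc t ^ n * aa B s n v ≤ t ^ n * (‖v‖ ^ s * (C * θ ^ n) ^ 2) := by
          gcongr
          refine (aa_le B s n v).trans ?_
          gcongr
          refine (SS_two B p n).trans ?_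
          have := SS_nonneg B p n
          gcongr
          exact hC n
      _ = _ := by ring
  set κ : ℝ := (1/2) ^ s / ((d:ℝ) ^ s + 1) with hκ
  have hκ0 : 0 < κ := by positivity
  have hlow : ∀ n, κ ≤ ∑ j, aa B s n (EuclideanSpace.single j 1) := by
    intro n
    obtain ⟨w, hw, hw1⟩ := H2 n
    refine (low_norm hs0 _ hw1).trans ?_
    refine Finset.sum_le_sum fun j _ => ?_
    subst hw
    exact le_wsum (F := fun w => ‖wp B w (EuclideanSpace.single j 1)‖ ^ s)
      (fun w => by positivity) w
  set F : ℝ → EuclideanSpace ℝ (Fin d) → ℝ := fun t v => ∑' n, t ^ n * aa B s n v with hF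
  have hFCH : ∀ t : ℝ, 0 ≤ t → t < 1 → CH s (F t) := by
    intro t ht0 ht1
    refine CH.lim (l := atTop) (g := fun N v => ∑ n ∈ Finset.range N, t ^ n * aa B s n v)
      (fun N => CH.sum _ fun n => (aa_CH B s n).smul (pow_nonneg ht0 n)) ?_
    intro v
    exact (hsummable t ht0 ht1 v).hasSum.tendsto_sum_nat
  have hFrec : ∀ t : ℝ, 0 ≤ t → t < 1 → ∀ v, F t v = ‖v‖ ^ s + t * ∑ i, F t (B i v) := by
    intro t ht0 ht1 v
    simp only [hF]
    rw [(hsummable t ht0 ht1 v).tsum_eq_zero_add]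
    congr 1
    · simp [aa, wsum_zero, wp]
    · rw [← Summable.tsum_finsetSum (fun i _ => hsummable t ht0 ht1 (B i v)), ← tsum_mul_left]
      refine tsum_congr fun n => ?_
      rw [aa_succ, Finset.mul_sum, Finset.mul_sum]
      refine Finset.sum_congr rfl fun i _ => ?_
      ring
  set Z : ℝ → ℝ := fun t => ∑ j, F t (EuclideanSpace.single j 1) with hZ
  have hZlow : ∀ t : ℝ, 0 ≤ t → t < 1 → κ / (1 - t) ≤ Z t := by
    intro t ht0 ht1
    have h1 : HasSum (fun n : ℕ => κ * t ^ n) (κ * (1 - t)⁻¹) :=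
      (hasSum_geometric_of_lt_one ht0 ht1).mul_left κ
    have h2 : HasSum (fun n => ∑ j : Fin d, t ^ n * aa B s n (EuclideanSpace.single j 1)) (Z t) :=
      hasSum_sum fun j _ => (hsummable t ht0 ht1 _).hasSum
    rw [div_eq_mul_inv]
    refine hasSum_le (fun n => ?_) h1 h2
    rw [← Finset.mul_sum, mul_comm]
    exact mul_le_mul_of_nonneg_left (hlow n) (pow_nonneg ht0 n)
  set t : ℕ → ℝ := fun k => 1 - 1 / ((k:ℝ) + 1) with ht
  have ht0 : ∀ k, 0 ≤ t k := by
    intro k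
    simp only [ht, sub_nonneg]
    rw [div_le_one (by positivity)]
    linarith [(Nat.cast_nonneg k : (0:ℝ) ≤ k)]
  have ht1 : ∀ k, t k < 1 := by
    intro k
    have : (0:ℝ) < 1 / ((k:ℝ) + 1) := by positivity
    simp only [ht]; linarith
  have hZpos : ∀ k, 0 < Z (t k) := fun k =>
    lt_of_lt_of_le (div_pos hκ0 (by linarith [ht1 k])) (hZlow _ (ht0 k) (ht1 k))
  set h : ℕ → EuclideanSpace ℝ (Fin d) → ℝ := fun k v => (Z (t k))⁻¹ * F (t k) v with hh
  have hhCH : ∀ k, CH s (h k) := fun k => (hFCH _ (ht0 k) (ht1 k)).smul (inv_nonneg.2 (hZpos k).le)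
  have hhsum : ∀ k, ∑ j, h k (EuclideanSpace.single j 1) = 1 := by
    intro k
    simp only [hh]
    rw [← Finset.mul_sum]
    exact inv_mul_cancel₀ (hZpos k).ne'
  have hhb : ∀ k v, h k v ∈ Set.Icc 0 ((d:ℝ) ^ s * ‖v‖ ^ s) := by
    intro k v
    refine ⟨(hhCH k).nonneg v, ?_⟩
    have := (hhCH k).jen v hs0
    rwa [hhsum, mul_one] at this
  let U : Ultrafilter ℕ := hyperfilter ℕ
  have hUlim : ∀ v, ∃ y, Tendsto (fun k => h k v) U (𝓝 y) := by
    intro v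
    obtain ⟨y, _, hy⟩ := (isCompact_Icc (a := (0:ℝ)) (b := (d:ℝ) ^ s * ‖v‖ ^ s)).ultrafilter_le_nhds
      (U.map (fun k => h k v)) (by
        rw [Filter.le_principal_iff]
        exact Filter.mem_map.2 (Filter.univ_mem' (fun k : ℕ => hhb k v)))
    exact ⟨y, hy⟩
  choose f hf using hUlim
  have hUle : (U : Filter ℕ) ≤ atTop := by
    rw [← Nat.cofinite_eq_atTop]; exact hyperfilter_le_cofinite
  have htlim : Tendsto (fun k : ℕ => 1 / ((k:ℝ) + 1)) U (𝓝 0) :=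
    tendsto_one_div_add_atTop_nhds_zero_nat.mono_left hUle
  have httend : Tendsto t U (𝓝 1) := by
    simpa [ht] using htlim.const_sub 1
  have hZinv : Tendsto (fun k => (Z (t k))⁻¹) U (𝓝 0) := by
    refine squeeze_zero (fun k : ℕ => inv_nonneg.2 (hZpos k).le) (g := fun k : ℕ => κ⁻¹ * (1 / ((k:ℝ) + 1))) ?_ ?_
    · intro k
      have h1 := hZlow _ (ht0 k) (ht1 k)
      have h2 : 0 < κ / (1 - t k) := div_pos hκ0 (by linarith [ht1 k])
      have h3 := inv_anti₀ h2 h1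
      refine h3.trans (le_of_eq ?_)
      rw [inv_div, div_eq_inv_mul]
      simp [ht]
    · simpa using htlim.const_mul κ⁻¹
  refine ⟨f, CH.lim hhCH hf, ?_, ?_⟩
  · intro v
    have hrec : ∀ k, h k v = (Z (t k))⁻¹ * ‖v‖ ^ s + t k * ∑ i, h k (B i v) := by
      intro k
      simp only [hh]
      rw [hFrec _ (ht0 k) (ht1 k) v, ← Finset.mul_sum]
      ring
    have h1 : Tendsto (fun k => h k v) U (𝓝 (0 * ‖v‖ ^ s + 1 * ∑ i, f (B i v))) := by
      simp_rw [hrec]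
      exact (hZinv.mul_const _).add (httend.mul (tendsto_finsetSum _ fun i _ => hf (B i v)))
    have := tendsto_nhds_unique (hf v) h1
    simpa using this
  · have h1 : Tendsto (fun k => ∑ j, h k (EuclideanSpace.single j 1)) U
        (𝓝 (∑ j, f (EuclideanSpace.single j 1))) := tendsto_finsetSum _ fun i _ => hf _
    simp_rw [hhsum] at h1
    exact tendsto_nhds_unique h1 tendsto_const_nhds

theorem core (p : ℕ) (hp : 0 < p)
    (H1 : ∀ θ : ℝ, 1 < θ → ∃ n0, 0 < n0 ∧ SS B p n0 ≤ θ ^ n0)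
    (H2 : ∀ n, ∃ w : List (Fin M), w.length = n ∧ 1 ≤ ‖wp B w‖) :
    ∃ w : List (Fin M), w ≠ [] ∧ ∀ k, 1 ≤ ‖wp B w ^ k‖ := by
  obtain ⟨f, hf, hinv, hsum1⟩ := exists_f B p hp H1 H2
  have hs0 : 2 * p ≠ 0 := by omega
  have hD : ∀ v, f v ≤ (d:ℝ) ^ (2 * p) * ‖v‖ ^ (2 * p) := by
    intro v
    have := hf.jen v hs0
    rwa [hsum1, mul_one] at this
  have hmono : ∀ w v, f (wp B w v) ≤ f v := by
    intro w v
    have := le_wsum (F := fun w => f (wp B w v)) (fun w => hf.nonneg _) w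
    rwa [wsum_inv B hinv] at this
  obtain ⟨C, hC0, hC⟩ := sem hs0 hf
  have hCw : ∀ w v, f (wp B w v) ≤ C * f v * ∑ j, f (wp B w (EuclideanSpace.single j 1)) :=
    fun w v => hC (wp B w) (fun u hu => le_antisymm (hu ▸ hmono w u) (hf.nonneg _)) v
  let L : List (Fin M) → Prop := fun w => ¬ ∃ m : ℝ, 0 ≤ m ∧ m < 1 ∧ ∀ v, f (wp B w v) ≤ m * f v
  have hgood : ∀ w, L w → 1/2 ≤ C * ∑ j, f (wp B w (EuclideanSpace.single j 1)) := by
    intro w hw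
    by_contra hlt
    push Not at hlt
    refine hw ⟨1/2, by norm_num, by norm_num, fun v => (hCw w v).trans ?_⟩
    calc _ = (C * ∑ j, f (wp B w (EuclideanSpace.single j 1))) * f v := by ring
      _ ≤ _ := mul_le_mul_of_nonneg_right hlt.le (hf.nonneg v)
  have hfac : ∀ a b c, L (a ++ (b ++ c)) → L b := by
    intro a b c h ⟨m, hm0, hm1, hm⟩
    refine h ⟨m, hm0, hm1, fun v => ?_⟩
    rw [wp_append, wp_append]
    calc f (wp B c (wp B b (wp B a v))) ≤ f (wp B b (wp B a v)) := hmono _ _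
      _ ≤ m * f (wp B a v) := hm _
      _ ≤ m * f v := mul_le_mul_of_nonneg_left (hmono _ _) hm0
  have hne : ∀ n, ∃ w : List (Fin M), w.length = n ∧ L w := by
    intro n
    by_contra hcon
    push Not at hcon
    have hbad : ∀ x : Fin n → Fin M, ∃ m : ℝ, 0 ≤ m ∧ m < 1 ∧
        ∀ v, f (wp B (List.ofFn x) v) ≤ m * f v := fun x =>
      not_not.1 (hcon (List.ofFn x) (by simp))
    choose g hg0 hg1 hg using hbad
    have : Nonempty (Fin n → Fin M) := by
      obtain ⟨w, hw, _⟩ := H2 n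
      subst hw
      exact ⟨w.get⟩
    obtain ⟨x0, hx0⟩ := Finite.exists_max g
    set m := g x0 with hm
    have hm0 : 0 ≤ m := hg0 x0
    have hm1 : m < 1 := hg1 x0
    have hone : ∀ w : List (Fin M), w.length = n → ∀ v, f (wp B w v) ≤ m * f v := by
      intro w hw v
      subst hw
      have h1 := hg w.get v
      rw [List.ofFn_get] at h1
      exact h1.trans (mul_le_mul_of_nonneg_right (hx0 _) (hf.nonneg v))
    have hmany : ∀ k, ∀ w : List (Fin M), w.length = k * n → ∀ v, f (wp B w v) ≤ m ^ k * f v := by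
      intro k
      induction k with
      | zero => intro w _ v; simpa using hmono w v
      | succ k ih =>
        intro w hw v
        rw [add_mul, one_mul] at hw
        rw [← List.take_append_drop n w, wp_append]
        have h1 := ih (w.drop n) (by simp [hw]) (wp B (w.take n) v)
        have h2 := hone (w.take n) (by simp [hw]) v
        calc _ ≤ _ := h1
          _ ≤ m ^ k * (m * f v) := mul_le_mul_of_nonneg_left h2 (by positivity)
          _ = _ := by ring
    set μ := Real.sqrt m with hμ
    have hμ0 : 0 ≤ μ := Real.sqrt_nonneg _
    have hμ1 : μ < 1 := by rw [hμ, Real.sqrt_lt' one_pos]; simpa using hm1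
    have hμ2 : μ ^ 2 = m := Real.sq_sqrt hm0
    obtain ⟨θ, hθ, hθ1⟩ : ∃ θ : ℝ, μ * θ ^ n < 1 ∧ 1 < θ := by
      have hc : Tendsto (fun θ : ℝ => μ * θ ^ n) (𝓝[>] 1) (𝓝 (μ * 1 ^ n)) :=
        (Continuous.tendsto (by fun_prop) 1).mono_left nhdsWithin_le_nhds
      have h1 : μ * 1 ^ n < 1 := by simpa using hμ1
      exact ((hc.eventually (gt_mem_nhds h1)).and self_mem_nhdsWithin).exists
    obtain ⟨n0, hn0, hS⟩ := H1 θ hθ1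
    obtain ⟨C', hC'0, hC'⟩ := SS_bound B p n0 hn0 θ hθ1 hS
    have hzero : ∀ v, f v ≤ 0 := by
      intro v
      set R := Real.sqrt (f v * (d:ℝ) ^ (2 * p)) with hR
      have hR0 : 0 ≤ R := Real.sqrt_nonneg _
      have hR2 : R ^ 2 = f v * (d:ℝ) ^ (2 * p) :=
        Real.sq_sqrt (mul_nonneg (hf.nonneg v) (by positivity))
      have hk : ∀ k : ℕ, f v ≤ (R * ‖v‖ ^ p * C') * (μ * θ ^ n) ^ k := by
        intro k
        calc f v = wsum (k * n) (fun w => f (wp B w v)) := (wsum_inv B hinv _ v).symm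
          _ ≤ wsum (k * n) (fun w => (μ ^ k * R * ‖v‖ ^ p) * ‖wp B w‖ ^ p) := by
            refine wsum_mono _ fun w hw => ?_
            have h1 := hmany k w hw v
            have h2 : f (wp B w v) ≤ (d:ℝ) ^ (2 * p) * (‖wp B w‖ * ‖v‖) ^ (2 * p) := by
              refine (hD _).trans (mul_le_mul_of_nonneg_left ?_ (by positivity))
              exact pow_le_pow_left₀ (norm_nonneg _) ((wp B w).le_opNorm v) _
            have h0 := hf.nonneg (wp B w v)
            refine (pow_le_pow_iff_left₀ h0 (by positivity) two_ne_zero).1 ?_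
            calc f (wp B w v) ^ 2 = f (wp B w v) * f (wp B w v) := by ring
              _ ≤ (m ^ k * f v) * ((d:ℝ) ^ (2 * p) * (‖wp B w‖ * ‖v‖) ^ (2 * p)) :=
                mul_le_mul h1 h2 h0 (h0.trans h1)
              _ = (μ ^ 2) ^ k * (f v * (d:ℝ) ^ (2 * p)) * (‖wp B w‖ * ‖v‖) ^ (2 * p) := by
                rw [hμ2]; ring
              _ = _ := by
                rw [← hR2]; ring
          _ = (μ ^ k * R * ‖v‖ ^ p) * SS B p (k * n) := wsum_mul _ _ _
          _ ≤ (μ ^ k * R * ‖v‖ ^ p) * (C' * θ ^ (k * n)) :=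
            mul_le_mul_of_nonneg_left (hC' _) (by positivity)
          _ = _ := by rw [mul_pow, ← pow_mul, mul_comm n k]; ring
      have hlim : Tendsto (fun k : ℕ => (R * ‖v‖ ^ p * C') * (μ * θ ^ n) ^ k) atTop (𝓝 0) := by
        simpa using (tendsto_pow_atTop_nhds_zero_of_lt_one (by positivity) hθ).const_mul
          (R * ‖v‖ ^ p * C')
      exact ge_of_tendsto' hlim hk
    have : ∑ j, f (EuclideanSpace.single j 1) ≤ 0 := Finset.sum_nonpos fun j _ => hzero _
    rw [hsum1] at this
    linarith
  have hN : ∀ n (T : Finset (List (Fin M))), (∀ w ∈ T, w.length = n ∧ L w) → T.card ≤ ⌈2 * C⌉₊ := by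
    intro n T hT
    have h1 : ∑ w ∈ T, (1/2 : ℝ) ≤ ∑ w ∈ T, C * ∑ j, f (wp B w (EuclideanSpace.single j 1)) :=
      Finset.sum_le_sum fun w hw => hgood w (hT w hw).2
    have h2 := sum_le_wsum (F := fun w => C * ∑ j, f (wp B w (EuclideanSpace.single j 1)))
      (fun w => mul_nonneg hC0 (Finset.sum_nonneg fun j _ => hf.nonneg _)) n T (fun w hw => (hT w hw).1)
    have h3 : wsum n (fun w => C * ∑ j, f (wp B w (EuclideanSpace.single j 1))) = C := by
      rw [wsum_mul]
      have : wsum n (fun w => ∑ j, f (wp B w (EuclideanSpace.single j 1)))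
          = ∑ j, wsum n (fun w => f (wp B w (EuclideanSpace.single j 1))) := by
        unfold wsum
        exact Finset.sum_comm
      rw [this]
      simp_rw [wsum_inv B hinv]
      rw [hsum1, mul_one]
    rw [h3] at h2
    have h4 := h1.trans h2
    rw [Finset.sum_const, nsmul_eq_mul] at h4
    have h5 : (T.card : ℝ) ≤ 2 * C := by linarith
    exact_mod_cast h5.trans (Nat.le_ceil _)
  obtain ⟨w, hw, hwL⟩ := comb L hfac hne _ hN
  refine ⟨w, hw, ?_⟩
  have hlow : ∀ k, 1/2 ≤ (C * (d * (d:ℝ) ^ (2 * p))) * ‖wp B w ^ k‖ ^ (2 * p) := by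
    intro k
    have h1 := hgood _ (hwL k)
    rw [wp_replicate] at h1
    refine h1.trans ?_
    rw [mul_assoc]
    refine mul_le_mul_of_nonneg_left ?_ hC0
    calc ∑ j, f ((wp B w ^ k) (EuclideanSpace.single j 1))
        ≤ ∑ j : Fin d, (d:ℝ) ^ (2 * p) * ‖wp B w ^ k‖ ^ (2 * p) := by
          refine Finset.sum_le_sum fun j _ => (hD _).trans ?_
          refine mul_le_mul_of_nonneg_left ?_ (by positivity)
          refine pow_le_pow_left₀ (norm_nonneg _) ?_ _
          have := (wp B w ^ k).le_opNorm (EuclideanSpace.single j 1)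
          simpa using this
      _ = _ := by simp [mul_assoc]
  intro k
  by_contra hlt
  push Not at hlt
  set y := ‖wp B w ^ k‖ with hy
  have hy0 : 0 ≤ y := norm_nonneg _
  have hlow2 : ∀ m : ℕ, 1/2 ≤ (C * (d * (d:ℝ) ^ (2 * p))) * (y ^ (2 * p)) ^ (m + 1) := by
    intro m
    refine (hlow (k * (m + 1))).trans ?_
    refine mul_le_mul_of_nonneg_left ?_ (by positivity)
    rw [← pow_mul, mul_comm (2 * p) (m + 1), pow_mul y]
    refine pow_le_pow_left₀ (norm_nonneg _) ?_ _
    rw [pow_mul]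
    exact norm_pow_le' _ (Nat.succ_pos m)
  have hlim : Tendsto (fun m : ℕ => (C * (d * (d:ℝ) ^ (2 * p))) * (y ^ (2 * p)) ^ (m + 1)) atTop
      (𝓝 (C * (d * (d:ℝ) ^ (2 * p)) * 0)) :=
    ((tendsto_pow_atTop_nhds_zero_of_lt_one (by positivity)
      (pow_lt_one₀ hy0 hlt hs0)).comp (tendsto_add_atTop_nat 1)).const_mul _
  have := ge_of_tendsto' hlim hlow2
  norm_num at this

theorem wp_smul (c : ℝ) (w : List (Fin M)) : wp (fun i => c • B i) w = c ^ w.length • wp B w := by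
  induction w with
  | nil => simp [wp]
  | cons i w ih =>
    rw [wp, ih, wp]
    refine ContinuousLinearMap.ext fun v => ?_
    simp [smul_smul, pow_succ, mul_comm]

end words

theorem exists_ofFn {α : Type*} {n : ℕ} (w : List α) (h : w.length = n) :
    ∃ x : Fin n → α, List.ofFn x = w := by
  subst h
  exact ⟨w.get, List.ofFn_get w⟩

theorem listProd_cons {M d : ℕ} (A : Fin M → Matrix (Fin d) (Fin d) ℝ) (i : Fin M) (w : List (Fin M)) :
    listProd A (i :: w) = listProd A w * A i := by
  simp [listProd]

theorem clm_listProd {M d : ℕ} (A : Fin M → Matrix (Fin d) (Fin d) ℝ) (w : List (Fin M)) :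
    Matrix.toEuclideanCLM (𝕜 := ℝ) (listProd A w) =
      wp (fun i => Matrix.toEuclideanCLM (𝕜 := ℝ) (A i)) w := by
  induction w with
  | nil => simp [listProd, wp]
  | cons i w ih => rw [listProd_cons, map_mul, ih, wp]

theorem wordProd_eq {M d n : ℕ} (A : Fin M → Matrix (Fin d) (Fin d) ℝ) (x : Fin n → Fin M) :
    wordProd A x = listProd A (List.ofFn x) := by
  simp [wordProd, listProd, List.map_ofFn, Function.comp_def]

theorem opNorm_wordProd {M d n : ℕ} (A : Fin M → Matrix (Fin d) (Fin d) ℝ) (x : Fin n → Fin M) :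
    opNorm (wordProd A x) = ‖wp (fun i => Matrix.toEuclideanCLM (𝕜 := ℝ) (A i)) (List.ofFn x)‖ := by
  rw [wordProd_eq, opNorm, clm_listProd]

theorem opNorm_wordProd_pow {M d n : ℕ} (A : Fin M → Matrix (Fin d) (Fin d) ℝ) (x : Fin n → Fin M)
    (k : ℕ) : opNorm (wordProd A x ^ k) =
      ‖wp (fun i => Matrix.toEuclideanCLM (𝕜 := ℝ) (A i)) (List.ofFn x) ^ k‖ := by
  rw [wordProd_eq, opNorm, map_pow, clm_listProd]

theorem opNorm_nonneg' {d : ℕ} (X : Matrix (Fin d) (Fin d) ℝ) : 0 ≤ opNorm X := norm_nonneg _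

theorem specRad_nonneg {d : ℕ} (X : Matrix (Fin d) (Fin d) ℝ) : 0 ≤ specRad X :=
  Real.iInf_nonneg fun _ => Real.rpow_nonneg (opNorm_nonneg' _) _

theorem specRad_le_jsr {M d n : ℕ} (A : Fin M → Matrix (Fin d) (Fin d) ℝ) (x : Fin (n+1) → Fin M) :
    specRad (wordProd A x) ^ ((1 : ℝ) / (n + 1)) ≤ jsr A := by
  refine le_ciInf fun N => ?_
  set T := fun i => Matrix.toEuclideanCLM (𝕜 := ℝ) (A i) with hT
  set J := ⨆ y : Fin (N + 1) → Fin M, opNorm (wordProd A y) with hJ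
  have hJ0 : 0 ≤ J := Real.iSup_nonneg fun y => opNorm_nonneg' _
  have h1 : ∀ w : List (Fin M), w.length = N + 1 → ‖wp T w‖ ≤ J := by
    intro w hw
    obtain ⟨y, rfl⟩ := exists_ofFn w hw
    rw [← opNorm_wordProd]
    exact le_ciSup (f := fun y : Fin (N + 1) → Fin M => opNorm (wordProd A y))
      (Set.finite_range _).bddAbove y
  have h2 : ∀ a, ∀ w : List (Fin M), w.length = a * (N + 1) → ‖wp T w‖ ≤ J ^ a := by
    intro a
    induction a with
    | zero =>
      intro w hw
      have : w = [] := by simpa using hw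
      subst this
      exact ContinuousLinearMap.norm_id_le (𝕜 := ℝ) (E := EuclideanSpace ℝ (Fin d))
    | succ a ih =>
      intro w hw
      rw [add_mul, one_mul] at hw
      rw [← List.take_append_drop (N+1) w, wp_append, pow_succ]
      refine (norm_mul_le _ _).trans ?_
      exact mul_le_mul (ih _ (by simp [hw])) (h1 _ (by simp [hw])) (norm_nonneg _) (by positivity)
  have h3 : opNorm (wordProd A x ^ (N + 1)) ≤ J ^ (n + 1) := by
    rw [opNorm_wordProd_pow, ← wp_replicate]
    apply h2
    simp [List.length_flatten]
    ring
  have h4 : specRad (wordProd A x) ≤ (J ^ (n + 1)) ^ ((1 : ℝ) / (N + 1)) := by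
    refine (ciInf_le ⟨0, ?_⟩ N).trans ?_
    · rintro _ ⟨k, rfl⟩
      exact Real.rpow_nonneg (opNorm_nonneg' _) _
    · exact Real.rpow_le_rpow (opNorm_nonneg' _) h3 (by positivity)
  refine (Real.rpow_le_rpow (specRad_nonneg _) h4 (by positivity)).trans (le_of_eq ?_)
  rw [← Real.rpow_natCast, ← Real.rpow_mul hJ0, ← Real.rpow_mul hJ0]
  congr 1
  push_cast
  field_simp

/-- if `ϱ_∞(A) = ϱ_{2ℓ}(A)` then the joint spectral radius is attained by the
spectral radius of some finite product. -/
theorem stmt_7 {M d : ℕ} (hM : 2 ≤ M)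
    (A : Fin M → Matrix (Fin d) (Fin d) ℝ) (ℓ : ℕ) (hℓ : 1 ≤ ℓ)
    (h : jsr A = pRadius A (2 * ℓ)) :
    ∃ (n : ℕ) (x : Fin (n + 1) → Fin M),
      specRad (wordProd A x) ^ ((1 : ℝ) / (n + 1)) = jsr A := by
  have hMne : Nonempty (Fin M) := ⟨⟨0, by omega⟩⟩
  set r := jsr A with hr
  have hr0 : 0 ≤ r := Real.iInf_nonneg fun n =>
    Real.rpow_nonneg (Real.iSup_nonneg fun y => opNorm_nonneg' _) _
  rcases hr0.eq_or_lt with hrz | hrpos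
  · refine ⟨0, fun _ => ⟨0, by omega⟩, le_antisymm (specRad_le_jsr A _) ?_⟩
    rw [← hrz]
    exact Real.rpow_nonneg (specRad_nonneg _) _
  set T := fun i => Matrix.toEuclideanCLM (𝕜 := ℝ) (A i) with hT
  set B := fun i => r⁻¹ • T i with hB
  have hBn : ∀ w, ‖wp B w‖ = (r ^ w.length)⁻¹ * ‖wp T w‖ := by
    intro w
    rw [hB, wp_smul, norm_smul, inv_pow, Real.norm_of_nonneg (by positivity)]
  have H1 : ∀ θ : ℝ, 1 < θ → ∃ n0, 0 < n0 ∧ SS B (2 * ℓ) n0 ≤ θ ^ n0 := by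
    intro θ hθ
    have hpR : (0:ℝ) < 2 * (ℓ:ℝ) := by positivity
    have hτ : 1 < θ ^ ((1:ℝ) / (2 * ℓ)) := Real.one_lt_rpow hθ (by positivity)
    have hlt : pRadius A (2 * ℓ) < r * θ ^ ((1:ℝ) / (2 * ℓ)) := by
      rw [← h]; exact lt_mul_of_one_lt_right hrpos hτ
    obtain ⟨n, hn⟩ := exists_lt_of_ciInf_lt hlt
    refine ⟨n + 1, Nat.succ_pos n, ?_⟩
    set Sg := ∑ x : Fin (n + 1) → Fin M, opNorm (wordProd A x) ^ (2 * (ℓ:ℝ)) with hSg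
    have hSg0 : 0 ≤ Sg := Finset.sum_nonneg fun x _ => Real.rpow_nonneg (opNorm_nonneg' _) _
    have hSS : SS B (2 * ℓ) (n + 1) = ((r ^ (n+1)) ^ (2 * ℓ))⁻¹ * Sg := by
      unfold SS wsum
      rw [hSg, Finset.mul_sum]
      refine Finset.sum_congr rfl fun x _ => ?_
      beta_reduce
      rw [hBn, List.length_ofFn, mul_pow, inv_pow, opNorm_wordProd, ← Real.rpow_natCast ‖_‖]
      push_cast
      rfl
    rw [hSS, inv_mul_le_iff₀ (by positivity)]
    have h1 := Real.rpow_le_rpow (Real.rpow_nonneg hSg0 _) hn.le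
      (show (0:ℝ) ≤ ((n:ℝ) + 1) * (2 * ℓ) by positivity)
    rw [← Real.rpow_mul hSg0, one_div_mul_cancel (by positivity), Real.rpow_one] at h1
    refine h1.trans (le_of_eq ?_)
    rw [Real.mul_rpow hrpos.le (by positivity), ← Real.rpow_mul (by positivity), ← pow_mul,
      ← Real.rpow_natCast r, ← Real.rpow_natCast θ]
    push_cast
    congr 2
    field_simp
  have H2' : ∀ n, ∃ w : List (Fin M), w.length = n + 1 ∧ 1 ≤ ‖wp B w‖ := by
    intro n
    have h1 : r ≤ (⨆ x : Fin (n + 1) → Fin M, opNorm (wordProd A x)) ^ ((1 : ℝ) / (n + 1)) := by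
      refine ciInf_le ⟨0, ?_⟩ n
      rintro _ ⟨k, rfl⟩
      exact Real.rpow_nonneg (Real.iSup_nonneg fun y => opNorm_nonneg' _) _
    obtain ⟨x, hx⟩ := exists_eq_ciSup_of_finite (f := fun x : Fin (n + 1) → Fin M => opNorm (wordProd A x))
    rw [← hx] at h1
    refine ⟨List.ofFn x, by simp, ?_⟩
    rw [hBn, List.length_ofFn, ← opNorm_wordProd, le_inv_mul_iff₀ (by positivity), mul_one]
    have h2 := pow_le_pow_left₀ hrpos.le h1 (n+1)
    rw [← Real.rpow_natCast (_ ^ _), ← Real.rpow_mul (opNorm_nonneg' _)] at h2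
    push_cast at h2
    rwa [one_div_mul_cancel (by positivity), Real.rpow_one] at h2
  have H2 : ∀ n, ∃ w : List (Fin M), w.length = n ∧ 1 ≤ ‖wp B w‖ := by
    intro n
    rcases n with _ | n
    · refine ⟨[], rfl, ?_⟩
      rcases subsingleton_or_nontrivial (EuclideanSpace ℝ (Fin d)) with hs | hs
      · obtain ⟨w, _, hw⟩ := H2' 0
        have : wp B w = 0 := by ext1 v; exact Subsingleton.elim _ _
        rw [this, norm_zero] at hw
        linarith
      · exact (norm_one (α := EuclideanSpace ℝ (Fin d) →L[ℝ] EuclideanSpace ℝ (Fin d))).ge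
    · exact H2' n
  obtain ⟨w, hw, hwk⟩ := core B (2 * ℓ) (by omega) H1 H2
  obtain ⟨n, hn⟩ : ∃ n, w.length = n + 1 :=
    Nat.exists_eq_succ_of_ne_zero (by simpa using hw)
  obtain ⟨x, rfl⟩ := exists_ofFn w hn
  refine ⟨n, x, le_antisymm (specRad_le_jsr A x) ?_⟩
  have h1 : r ^ (n + 1) ≤ specRad (wordProd A x) := by
    refine le_ciInf fun k => ?_
    have h2 := hwk (k + 1)
    rw [← wp_replicate, hBn, wp_replicate, le_inv_mul_iff₀ (by positivity), mul_one,
      ← opNorm_wordProd_pow] at h2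
    have e : (List.replicate (k+1) (List.ofFn x)).flatten.length = (n + 1) * (k + 1) := by
      simp [List.length_flatten]; ring
    rw [e, pow_mul] at h2
    have h3 := Real.rpow_le_rpow (by positivity) h2 (show (0:ℝ) ≤ 1 / ((k:ℝ) + 1) by positivity)
    rw [← Real.rpow_natCast (r ^ (n+1)), ← Real.rpow_mul (by positivity)] at h3
    push_cast at h3
    rwa [mul_one_div_cancel (by positivity), Real.rpow_one] at h3
  have h3 := Real.rpow_le_rpow (by positivity) h1 (show (0:ℝ) ≤ 1 / ((n:ℝ) + 1) by positivity)
  rw [← Real.rpow_natCast r, ← Real.rpow_mul hrpos.le] at h3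
  push_cast at h3
  rwa [mul_one_div_cancel (by positivity), Real.rpow_one] at h3
end
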